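/- arXiv:1701.00377 — 3 statements merged into one kernel-verified Lean document; each statement's English description precedes it below -/
import Mathlib

section
/- Let G be an irreducible subgroup of IET (every G-orbit is dense in [0,1)), and let A be an abelian normal subgroup of G containing an element of infinite order. Then G is virtually abelian. In particular, if G is finitely generated, then A is finitely generated. -/
abbrev I01 : Set ℝ := Set.Ico (0 : ℝ) 1

def IsIET (T : Equiv.Perm I01) : Prop :=
  ∃ (n : ℕ) (a : Fin (n + 1) → ℝ), StrictMono a ∧ a 0 = 0 ∧ a (Fin.last n) = 1 ∧
    ∀ i : Fin n, ∃ c : ℝ, ∀ x : I01, (x : ℝ) ∈ Set.Ico (a i.castSucc) (a i.succ) →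
      ((T x : ℝ)) = (x : ℝ) + c

section
open Set Filter Topology MeasureTheory


/-! ### One-sided neighbourhoods -/

theorem ietx_ev_right {x : ℝ} {p : ℝ → Prop} (h : ∀ᶠ y in 𝓝[>] x, p y) :
    ∀ᶠ y in 𝓝[>] x, ∀ᶠ z in 𝓝 y, p z := by
  have h2 := eventually_eventually_nhdsWithin.2 h
  filter_upwards [h2, self_mem_nhdsWithin] with y hy hxy
  rwa [IsOpen.nhdsWithin_eq isOpen_Ioi hxy] at hy

theorem ietx_ev_left {x : ℝ} {p : ℝ → Prop} (h : ∀ᶠ y in 𝓝[<] x, p y) :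
    ∀ᶠ y in 𝓝[<] x, ∀ᶠ z in 𝓝 y, p z := by
  have h2 := eventually_eventually_nhdsWithin.2 h
  filter_upwards [h2, self_mem_nhdsWithin] with y hy hxy
  rwa [IsOpen.nhdsWithin_eq isOpen_Iio hxy] at hy

theorem ietx_finite_of_isolated {D : Set ℝ} (hD : D ⊆ Icc 0 1)
    (h1 : ∀ x, ∀ᶠ y in 𝓝[>] x, y ∉ D) (h2 : ∀ x, ∀ᶠ y in 𝓝[<] x, y ∉ D) : D.Finite := by
  have key : ∀ x ∈ Icc (0:ℝ) 1, {y | y ∈ D → y = x} ∈ 𝓝 x := by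
    intro x _
    have : ∀ᶠ y in 𝓝[≠] x, y ∉ D := by
      rw [punctured_nhds_eq_nhdsWithin_sup_nhdsWithin, eventually_sup]
      exact ⟨h2 x, h1 x⟩
    rw [eventually_nhdsWithin_iff] at this
    filter_upwards [this] with y hy hyD
    by_contra hne
    exact hy hne hyD
  obtain ⟨t, _, ht⟩ := isCompact_Icc.elim_nhds_subcover _ key
  refine t.finite_toSet.subset fun y hy => ?_
  have := ht (hD hy)
  simp only [mem_iUnion] at this
  obtain ⟨x, hx, hyx⟩ := this
  rw [hyx hy]; exact hx

/-- left germs of a set -/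
def Ietx.lft (S : Set ℝ) : Set ℝ := {x | ∀ᶠ y in 𝓝[<] x, y ∈ S}

/-- elementary sets: locally finite unions of half-open intervals -/
def Ietx.Elem (S : Set ℝ) : Prop :=
  (∀ x, ∀ᶠ y in 𝓝[>] x, (y ∈ S ↔ x ∈ S)) ∧
    ∀ x, (∀ᶠ y in 𝓝[<] x, y ∈ S) ∨ ∀ᶠ y in 𝓝[<] x, y ∉ S

/-- boundary points -/
def Ietx.bd (S : Set ℝ) : Set ℝ := {x | ¬ (x ∈ S ↔ x ∈ Ietx.lft S)}

namespace Ietx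

theorem lft_ev {S : Set ℝ} {x : ℝ} (h : x ∈ lft S) : ∀ᶠ y in 𝓝[<] x, y ∈ S := h

theorem Elem.ev_left {S : Set ℝ} (h : Elem S) (x : ℝ) :
    ∀ᶠ y in 𝓝[<] x, (y ∈ S ↔ x ∈ lft S) := by
  rcases h.2 x with h1 | h1
  · filter_upwards [h1] with y hy
    exact ⟨fun _ => h1, fun _ => hy⟩
  · filter_upwards [h1] with y hy
    refine ⟨fun h => absurd h hy, fun h2 => ?_⟩
    exfalso
    obtain ⟨z, hz1, hz2⟩ := (h1.and h2).exists
    exact hz1 hz2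

theorem Elem.mk' {S : Set ℝ} (h1 : ∀ x, ∀ᶠ y in 𝓝[>] x, (y ∈ S ↔ x ∈ S))
    (h2 : ∀ x, ∃ p : Prop, ∀ᶠ y in 𝓝[<] x, (y ∈ S ↔ p)) : Elem S := by
  refine ⟨h1, fun x => ?_⟩
  obtain ⟨p, hp⟩ := h2 x
  by_cases h : p
  · left; filter_upwards [hp] with y hy; exact hy.2 h
  · right; filter_upwards [hp] with y hy; exact fun h' => h (hy.1 h')

theorem mem_lft_iff {S : Set ℝ} {x : ℝ} {p : Prop} (h : ∀ᶠ y in 𝓝[<] x, (y ∈ S ↔ p)) :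
    x ∈ lft S ↔ p := by
  constructor
  · intro h2
    obtain ⟨z, hz1, hz2⟩ := (h.and h2).exists
    exact hz1.1 hz2
  · intro hp
    filter_upwards [h] with y hy
    exact hy.2 hp

theorem Elem.compl {S : Set ℝ} (h : Elem S) : Elem Sᶜ :=
  Elem.mk' (fun x => by filter_upwards [h.1 x] with y hy; simp [hy])
    (fun x => ⟨x ∉ lft S, by filter_upwards [h.ev_left x] with y hy; simp [hy]⟩)

theorem Elem.inter {S T : Set ℝ} (h : Elem S) (h' : Elem T) : Elem (S ∩ T) :=
  Elem.mk' (fun x => by filter_upwards [h.1 x, h'.1 x] with y hy hy'; simp [hy, hy'])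
    (fun x => ⟨x ∈ lft S ∧ x ∈ lft T, by
      filter_upwards [h.ev_left x, h'.ev_left x] with y hy hy'; simp [hy, hy']⟩)

theorem Elem.symmd {S T : Set ℝ} (h : Elem S) (h' : Elem T) : Elem {x | ¬ (x ∈ S ↔ x ∈ T)} :=
  Elem.mk' (fun x => by filter_upwards [h.1 x, h'.1 x] with y hy hy'; simp [hy, hy'])
    (fun x => ⟨¬ (x ∈ lft S ↔ x ∈ lft T), by
      filter_upwards [h.ev_left x, h'.ev_left x] with y hy hy'; simp [hy, hy']⟩)

theorem Elem.lft_symmd {S T : Set ℝ} (h : Elem S) (h' : Elem T) (x : ℝ) :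
    x ∈ lft {x | ¬ (x ∈ S ↔ x ∈ T)} ↔ ¬ (x ∈ lft S ↔ x ∈ lft T) := by
  apply mem_lft_iff
  filter_upwards [h.ev_left x, h'.ev_left x] with y hy hy'; simp [hy, hy']

theorem Elem.exists_bd {S : Set ℝ} (h : Elem S) (hS : S ⊆ Ico 0 1) (hne : S.Nonempty) :
    ∃ x ∈ S, x ∉ lft S := by
  have hb : BddBelow S := ⟨0, fun x hx => (hS hx).1⟩
  have hmem : sInf S ∈ S := by
    by_contra hc
    have h1 := h.1 (sInf S)
    rw [eventually_nhdsWithin_iff, Metric.eventually_nhds_iff] at h1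
    obtain ⟨e, he, h2⟩ := h1
    obtain ⟨y, hy, hy2⟩ := exists_lt_of_csInf_lt hne (show sInf S < sInf S + e by linarith)
    have h3 : sInf S ≤ y := csInf_le hb hy
    have h4 : sInf S ≠ y := fun h => hc (h ▸ hy)
    have h5 : sInf S < y := lt_of_le_of_ne h3 h4
    have := h2 (y := y) (by rw [Real.dist_eq, abs_lt]; constructor <;> linarith) h5
    exact hc (this.1 hy)
  refine ⟨_, hmem, fun hl => ?_⟩
  obtain ⟨y, hy1, hy2⟩ := ((lft_ev hl).and (self_mem_nhdsWithin)).exists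
  exact absurd (csInf_le hb hy1) (not_le.2 hy2)

theorem Elem.bd_finite {S : Set ℝ} (h : Elem S) (hS : S ⊆ Ico 0 1) : (bd S).Finite := by
  apply ietx_finite_of_isolated
  · intro x hx
    by_contra hc
    apply hx
    rcases lt_or_ge x 0 with h0 | h0
    · have h1 : x ∉ S := fun h => by have := (hS h).1; linarith
      have h2 : x ∉ lft S := fun h => by
        obtain ⟨y, hy1, hy2⟩ := ((lft_ev h).and (self_mem_nhdsWithin)).exists
        have := (hS hy1).1
        have hy2 : y < x := hy2
        linarith
      simp [h1, h2]
    · have h1' : 1 < x := by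
        by_contra h; exact hc ⟨h0, not_lt.1 h⟩
      have h1 : x ∉ S := fun h => by have := (hS h).2; linarith
      have h2 : x ∉ lft S := fun h => by
        obtain ⟨y, hy1, hy2⟩ := ((lft_ev h).and
          (Ioo_mem_nhdsLT h1')).exists
        have := (hS hy1).2
        have hy2 := hy2.1
        linarith
      simp [h1, h2]
  · intro x
    filter_upwards [ietx_ev_right (h.1 x)] with y hy hyb
    apply hyb
    have h1 := hy.self_of_nhds
    rw [h1, mem_lft_iff (hy.filter_mono nhdsWithin_le_nhds)]
  · intro x
    filter_upwards [ietx_ev_left (h.ev_left x)] with y hy hyb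
    apply hyb
    have h1 := hy.self_of_nhds
    rw [h1, mem_lft_iff (hy.filter_mono nhdsWithin_le_nhds)]

theorem Elem.eq_of_bd {S T E : Set ℝ} (h : Elem S) (h' : Elem T) (hS : S ⊆ Ico 0 1)
    (hT : T ⊆ Ico 0 1) (hSE : bd S ⊆ E) (hTE : bd T ⊆ E) (heq : S ∩ E = T ∩ E) : S = T := by
  by_contra hne
  have hW := h.symmd h'
  obtain ⟨x, hx1, hx2⟩ := hW.exists_bd (by
    intro x hx
    by_contra hc
    exact hx ⟨fun h => absurd (hS h) hc, fun h => absurd (hT h) hc⟩) (by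
    by_contra hc
    apply hne
    ext x
    by_contra hx
    exact hc ⟨x, hx⟩)
  rw [h.lft_symmd h'] at hx2
  have hxE : x ∉ E := by
    intro hE
    apply hx1
    have := Set.ext_iff.1 heq x
    simpa [hE] using this
  have a1 : x ∈ S ↔ x ∈ lft S := by
    by_contra hc; exact hxE (hSE hc)
  have a2 : x ∈ T ↔ x ∈ lft T := by
    by_contra hc; exact hxE (hTE hc)
  apply hx1
  rw [a1, a2]; tauto

theorem finite_of_bd {E : Set ℝ} (hE : E.Finite) {F : Set (Set ℝ)}
    (hF : ∀ S ∈ F, Elem S ∧ S ⊆ Ico 0 1 ∧ bd S ⊆ E) : F.Finite := by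
  refine Set.Finite.of_finite_image (f := fun S => S ∩ E) ?_ ?_
  · apply hE.finite_subsets.subset
    rintro _ ⟨S, _, rfl⟩
    exact inter_subset_right
  · intro S hS T hT heq
    exact (hF S hS).1.eq_of_bd (hF T hT).1 (hF S hS).2.1 (hF T hT).2.1 (hF S hS).2.2
      (hF T hT).2.2 heq

theorem Elem.exists_Ioo {S : Set ℝ} (h : Elem S) {x : ℝ} (hx : x ∈ S) :
    ∃ v, x < v ∧ Ioo x v ⊆ S := by
  have h1 : ∀ᶠ y in 𝓝[>] x, y ∈ S := by
    filter_upwards [h.1 x] with y hy; exact hy.2 hx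
  exact mem_nhdsGT_iff_exists_Ioo_subset.1 h1

theorem Elem.measurable {S : Set ℝ} (h : Elem S) (hS : S ⊆ Ico 0 1) : MeasurableSet S := by
  have : S = interior S ∪ (S ∩ bd S) := by
    ext x
    constructor
    · intro hx
      by_cases hb : x ∈ bd S
      · exact Or.inr ⟨hx, hb⟩
      · left
        have hl : x ∈ lft S := by
          by_contra hc; exact hb (fun h => hc (h.1 hx))
        rw [mem_interior_iff_mem_nhds]
        have : ∀ᶠ y in 𝓝[≠] x, y ∈ S := by
          rw [punctured_nhds_eq_nhdsWithin_sup_nhdsWithin, eventually_sup]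
          refine ⟨hl, ?_⟩
          filter_upwards [h.1 x] with y hy; exact hy.2 hx
        rw [eventually_nhdsWithin_iff] at this
        filter_upwards [this] with y hy
        by_cases hyx : y = x
        · rw [hyx]; exact hx
        · exact hy hyx
    · rintro (h | h)
      · exact interior_subset h
      · exact h.1
  rw [this]
  exact isOpen_interior.measurableSet.union
    (((h.bd_finite hS).subset inter_subset_right).measurableSet)

/-- points lying on orbit segments between points of a finite set -/
theorem finite_conn {α : Type*} (f : Equiv.Perm α) {F : Set α} (hF : F.Finite) :
    {x | (∃ n : ℕ, (f ^ n) x ∈ F) ∧ ∃ m : ℕ, ((f ^ m)⁻¹) x ∈ F}.Finite := by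
  have : {x | (∃ n : ℕ, (f ^ n) x ∈ F) ∧ ∃ m : ℕ, ((f ^ m)⁻¹) x ∈ F} ⊆
      ⋃ p ∈ F, ⋃ q ∈ F, {x | ∃ n m : ℕ, (f ^ n) x = q ∧ x = (f ^ m) p} := by
    rintro x ⟨⟨n, hn⟩, m, hm⟩
    simp only [mem_iUnion]
    exact ⟨_, hm, _, hn, n, m, rfl, by simp⟩
  refine Set.Finite.subset ?_ this
  refine hF.biUnion fun p _ => hF.biUnion fun q _ => ?_
  by_cases hp : ∃ k : ℕ, 0 < k ∧ (f ^ k) p = p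
  · obtain ⟨k, hk, hkp⟩ := hp
    refine ((Finset.range k).finite_toSet.image (fun i => (f ^ i) p)).subset ?_
    rintro x ⟨n, m, _, rfl⟩
    refine ⟨m % k, by simpa using Nat.mod_lt _ hk, ?_⟩
    have h2 : ∀ j : ℕ, (f ^ (k * j)) p = p := by
      intro j
      induction j with
      | zero => simp
      | succ j ih => rw [mul_add, pow_add, mul_one, Equiv.Perm.mul_apply, hkp, ih]
    conv_rhs => rw [← Nat.mod_add_div m k, pow_add, Equiv.Perm.mul_apply, h2]
  · push Not at hp
    by_cases hq : ∃ K : ℕ, (f ^ K) p = q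
    · obtain ⟨K, hK⟩ := hq
      refine ((Finset.range (K + 1)).finite_toSet.image (fun i => (f ^ i) p)).subset ?_
      rintro x ⟨n, m, hn, rfl⟩
      refine ⟨m, ?_, rfl⟩
      rw [← Equiv.Perm.mul_apply, ← pow_add] at hn
      simp only [Finset.coe_range, mem_Iio]
      by_contra hlt
      apply hp (n + m - K) (by omega)
      apply (f ^ K).injective
      rw [← Equiv.Perm.mul_apply, ← pow_add, hK, ← hn]
      congr 2; omega
    · convert Set.finite_empty
      ext x
      simp only [mem_ofPred_eq, mem_empty_iff_false, iff_false]
      rintro ⟨n, m, h1, rfl⟩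
      exact hq ⟨n + m, by rw [pow_add]; exact h1⟩

end Ietx


/-- A group acting by piecewise translations, with actions on right germs and left germs. -/
structure Ietx.Sys (G : Type*) [Group G] where
  R : G →* Equiv.Perm ℝ
  L : G →* Equiv.Perm ℝ
  hR : ∀ g x, ∀ᶠ y in 𝓝[>] x, R g y = y + (R g x - x)
  hL : ∀ g x, ∀ᶠ y in 𝓝[<] x, R g y = y + (L g x - x)
  out : ∀ g x, x ∉ Ico (0:ℝ) 1 → R g x = x
  inj : ∀ g, (∀ x, R g x = x) → g = 1
  dens : ∀ x ∈ Ico (0:ℝ) 1, ∀ u v : ℝ, 0 ≤ u → u < v → v ≤ 1 → ∃ g, R g x ∈ Ioo u v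
  mp : ∀ g, MeasurePreserving (R g) volume volume

namespace Ietx
namespace Sys

variable {G : Type*} [Group G] (s : Sys G)

theorem R_mul (g h : G) (x : ℝ) : s.R (g * h) x = s.R g (s.R h x) := by simp
theorem L_mul (g h : G) (x : ℝ) : s.L (g * h) x = s.L g (s.L h x) := by simp

theorem R_mem_Ico {g : G} {x : ℝ} (hx : x ∈ Ico (0:ℝ) 1) : s.R g x ∈ Ico (0:ℝ) 1 := by
  by_contra hc
  have h1 := s.out g⁻¹ _ hc
  rw [← R_mul] at h1
  simp only [inv_mul_cancel, map_one, Equiv.Perm.coe_one, id_eq] at h1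
  exact hc (h1 ▸ hx)

theorem L_eq {g : G} {x z : ℝ} (h : ∀ᶠ y in 𝓝[<] x, s.R g y = y + (z - x)) : s.L g x = z := by
  obtain ⟨y, h1, h2⟩ := (h.and (s.hL g x)).exists
  linarith

theorem tendsto_R (g : G) (x : ℝ) : Tendsto (s.R g) (𝓝[>] x) (𝓝[>] (s.R g x)) := by
  have h1 : Tendsto (fun y => y + (s.R g x - x)) (𝓝[>] x) (𝓝[>] (s.R g x)) := by
    apply tendsto_nhdsWithin_of_tendsto_nhds_of_eventually_within
    · have : Tendsto (fun y => y + (s.R g x - x)) (𝓝 x) (𝓝 (x + (s.R g x - x))) :=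
        (continuous_id.add continuous_const).tendsto x
      rw [add_sub_cancel] at this
      exact this.mono_left nhdsWithin_le_nhds
    · filter_upwards [self_mem_nhdsWithin] with y hy
      have hy : x < y := hy
      show s.R g x < _
      linarith
  refine h1.congr' ?_
  filter_upwards [s.hR g x] with y hy
  exact hy.symm

theorem tendsto_L (g : G) (x : ℝ) : Tendsto (s.R g) (𝓝[<] x) (𝓝[<] (s.L g x)) := by
  have h1 : Tendsto (fun y => y + (s.L g x - x)) (𝓝[<] x) (𝓝[<] (s.L g x)) := by
    apply tendsto_nhdsWithin_of_tendsto_nhds_of_eventually_within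
    · have : Tendsto (fun y => y + (s.L g x - x)) (𝓝 x) (𝓝 (x + (s.L g x - x))) :=
        (continuous_id.add continuous_const).tendsto x
      rw [add_sub_cancel] at this
      exact this.mono_left nhdsWithin_le_nhds
    · filter_upwards [self_mem_nhdsWithin] with y hy
      have hy : y < x := hy
      show _ < s.L g x
      linarith
  refine h1.congr' ?_
  filter_upwards [s.hL g x] with y hy
  exact hy.symm

theorem L_out (g : G) {x : ℝ} (hx : x ∉ Ioc (0:ℝ) 1) : s.L g x = x := by
  apply s.L_eq
  rcases le_or_gt x 0 with h | h
  · filter_upwards [self_mem_nhdsWithin] with y hy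
    have hy : y < x := hy
    rw [s.out g y (fun hc => by have := hc.1; linarith)]; ring
  · have h1 : 1 < x := by
      by_contra hc; exact hx ⟨h, not_lt.1 hc⟩
    filter_upwards [Ioo_mem_nhdsLT h1] with y hy
    rw [s.out g y (fun hc => by have := hc.2; have := hy.1; linarith)]; ring

theorem L_mem_Ioc {g : G} {x : ℝ} (hx : x ∈ Ioc (0:ℝ) 1) : s.L g x ∈ Ioc (0:ℝ) 1 := by
  by_contra hc
  have h1 := s.L_out g⁻¹ hc
  rw [← L_mul] at h1
  simp only [inv_mul_cancel, map_one, Equiv.Perm.coe_one, id_eq] at h1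
  exact hc (h1 ▸ hx)

/-- discontinuities -/
def D (g : G) : Set ℝ := {x | s.L g x ≠ s.R g x}

theorem not_mem_D {g : G} {x : ℝ} : x ∉ s.D g ↔ s.L g x = s.R g x := by
  simp [D]

theorem D_finite (g : G) : (s.D g).Finite := by
  apply ietx_finite_of_isolated
  · intro x hx
    by_contra hc
    apply hx
    rw [s.L_out g (fun h => hc ⟨h.1.le, h.2⟩), s.out g x (fun h => hc ⟨h.1, h.2.le⟩)]
  · intro x
    filter_upwards [ietx_ev_right (s.hR g x)] with y hy
    rw [not_mem_D]
    apply s.L_eq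
    have h1 := hy.self_of_nhds
    filter_upwards [hy.filter_mono nhdsWithin_le_nhds] with z hz
    linarith
  · intro x
    filter_upwards [ietx_ev_left (s.hL g x)] with y hy
    rw [not_mem_D]
    apply s.L_eq
    have h1 := hy.self_of_nhds
    filter_upwards [hy.filter_mono nhdsWithin_le_nhds] with z hz
    linarith

theorem lft_preimage_aux (g : G) {x : ℝ} {S : Set ℝ} (h : s.L g x ∈ lft S) :
    x ∈ lft (s.R g ⁻¹' S) := (s.tendsto_L g x).eventually (lft_ev h)

theorem lft_preimage (g : G) (x : ℝ) (S : Set ℝ) :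
    x ∈ lft (s.R g ⁻¹' S) ↔ s.L g x ∈ lft S := by
  refine ⟨fun h => ?_, s.lft_preimage_aux g⟩
  have := s.lft_preimage_aux g⁻¹ (x := s.L g x) (S := s.R g ⁻¹' S) (by
    rw [← L_mul]; simpa using h)
  rw [← preimage_comp] at this
  have h2 : (⇑(s.R g) ∘ ⇑(s.R g⁻¹)) = id := by
    ext y; simp
  rwa [h2] at this

theorem elem_preimage (g : G) {S : Set ℝ} (h : Elem S) : Elem (s.R g ⁻¹' S) :=
  Elem.mk' (fun x => (s.tendsto_R g x).eventually (h.1 (s.R g x)))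
    (fun x => ⟨_, (s.tendsto_L g x).eventually (h.ev_left (s.L g x))⟩)

theorem preimage_Ico (g : G) {S : Set ℝ} (h : S ⊆ Ico (0:ℝ) 1) : s.R g ⁻¹' S ⊆ Ico (0:ℝ) 1 := by
  intro x hx
  have := s.R_mem_Ico (g := g⁻¹) (h hx)
  rw [← R_mul] at this
  simpa using this

/-- the support of `g` -/
def moved (g : G) : Set ℝ := {x | s.R g x ≠ x}

theorem mem_moved {g : G} {x : ℝ} : x ∈ s.moved g ↔ s.R g x ≠ x := Iff.rfl

theorem moved_sub (g : G) : s.moved g ⊆ Ico 0 1 := by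
  intro x hx
  by_contra hc
  exact hx (s.out g x hc)

theorem ev_moved_left (g : G) (x : ℝ) : ∀ᶠ y in 𝓝[<] x, (y ∈ s.moved g ↔ s.L g x ≠ x) := by
  filter_upwards [s.hL g x] with y hy
  rw [mem_moved, hy]
  constructor <;> intro h h2 <;> apply h <;> linarith

theorem elem_moved (g : G) : Elem (s.moved g) := by
  refine Elem.mk' (fun x => ?_) (fun x => ⟨_, s.ev_moved_left g x⟩)
  filter_upwards [s.hR g x] with y hy
  rw [mem_moved, mem_moved, hy]
  constructor <;> intro h h2 <;> apply h <;> linarith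

theorem lft_moved (g : G) (x : ℝ) : x ∈ lft (s.moved g) ↔ s.L g x ≠ x :=
  mem_lft_iff (s.ev_moved_left g x)

/-- invariance -/
def Inv (A : Subgroup G) (S : Set ℝ) : Prop := ∀ b ∈ A, ∀ x, (s.R b x ∈ S ↔ x ∈ S)

variable {s}

theorem Inv.preimage {A : Subgroup G} {S : Set ℝ} (h : s.Inv A S) {b : G} (hb : b ∈ A) :
    s.R b ⁻¹' S = S := by
  ext x; exact h b hb x

theorem Inv.lft {A : Subgroup G} {S : Set ℝ} (h : s.Inv A S) {b : G} (hb : b ∈ A) (x : ℝ) :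
    s.L b x ∈ Ietx.lft S ↔ x ∈ Ietx.lft S := by
  rw [← lft_preimage, h.preimage hb]

theorem Inv.inter {A : Subgroup G} {S T : Set ℝ} (h : s.Inv A S) (h' : s.Inv A T) :
    s.Inv A (S ∩ T) := fun b hb x => by
  simp only [mem_inter_iff, h b hb x, h' b hb x]

theorem Inv.compl {A : Subgroup G} {S : Set ℝ} (h : s.Inv A S) :
    s.Inv A Sᶜ := fun b hb x => by
  simp only [mem_compl_iff, h b hb x]

variable (s)

theorem inv_moved {A : Subgroup G} {c : G} (hc : ∀ b ∈ A, c * b = b * c) :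
    s.Inv A (s.moved c) := by
  intro b hb x
  rw [mem_moved, mem_moved, ← R_mul, hc b hb, R_mul, not_iff_not]
  exact (s.R b).apply_eq_iff_eq

theorem inv_gpreimage {A : Subgroup G} [A.Normal] {S : Set ℝ} (h : s.Inv A S) (g : G) :
    s.Inv A (s.R g ⁻¹' S) := by
  intro b hb x
  rw [mem_preimage, mem_preimage, ← R_mul,
    show g * b = (g * b * g⁻¹) * g by group, R_mul]
  exact h _ (Subgroup.Normal.conj_mem inferInstance b hb g) _

def Dd (a : G) : Set ℝ := s.D a ∪ s.D a⁻¹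

theorem Dd_finite (a : G) : (s.Dd a).Finite := (s.D_finite a).union (s.D_finite a⁻¹)

theorem Dd_inv (a : G) : s.Dd a⁻¹ = s.Dd a := by
  rw [Dd, Dd, inv_inv, union_comm]

def Conn (a : G) : Set ℝ :=
  {x | (∃ n : ℕ, s.L (a ^ n) x ∈ s.Dd a) ∧ ∃ m : ℕ, s.L (a⁻¹ ^ m) x ∈ s.Dd a}

def ConnR (a : G) : Set ℝ :=
  {x | (∃ n : ℕ, s.R (a ^ n) x ∈ s.Dd a) ∧ ∃ m : ℕ, s.R (a⁻¹ ^ m) x ∈ s.Dd a}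

theorem Conn_finite (a : G) : (s.Conn a).Finite := by
  have := finite_conn (s.L a) (s.Dd_finite a)
  simpa [Conn] using this

theorem ConnR_finite (a : G) : (s.ConnR a).Finite := by
  have := finite_conn (s.R a) (s.Dd_finite a)
  simpa [ConnR] using this

theorem agree_of_L {a : G} {x : ℝ} (h : ∀ n : ℕ, s.L (a ^ n) x ∉ s.D a) (n : ℕ) :
    s.L (a ^ n) x = s.R (a ^ n) x := by
  induction n with
  | zero => simp
  | succ n ih => rw [pow_succ', L_mul, R_mul, ← ih, (s.not_mem_D).1 (h n)]

theorem agree_of_R {a : G} {x : ℝ} (h : ∀ n : ℕ, s.R (a ^ n) x ∉ s.D a) (n : ℕ) :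
    s.L (a ^ n) x = s.R (a ^ n) x := by
  induction n with
  | zero => simp
  | succ n ih => rw [pow_succ', L_mul, R_mul, ih, (s.not_mem_D).1 (h n)]

theorem back {a : G} {x y : ℝ} (n : ℕ) (h : s.L (a ^ n) x = s.R (a ^ n) y)
    (h2 : ∀ i : ℕ, s.L (a ^ i) x ∉ s.Dd a) : x = y := by
  induction n with
  | zero => simpa using h
  | succ n ih =>
    apply ih
    have h3 : s.L (a ^ (n+1)) x ∉ s.D a⁻¹ := fun hc => h2 (n+1) (Or.inr hc)
    rw [not_mem_D] at h3
    have h4 : a ^ n = a⁻¹ * a ^ (n+1) := by rw [pow_succ']; group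
    rw [h4, L_mul, R_mul, ← h, h3]

theorem conn_of_ne {a : G} {x y : ℝ} (hxy : x ≠ y) (n m : ℕ)
    (hn : s.L (a ^ n) x = s.R (a ^ n) y) (hm : s.L (a⁻¹ ^ m) x = s.R (a⁻¹ ^ m) y) :
    x ∈ s.Conn a := by
  constructor
  · by_contra hc
    push Not at hc
    exact hxy (s.back n hn hc)
  · by_contra hc
    push Not at hc
    exact hxy (s.back m hm (by rwa [Dd_inv]))

theorem orbit_contra {A : Subgroup G} {S : Set ℝ} (hE : Elem S) (hS : S ⊆ Ico 0 1)
    (hI : s.Inv A S) {a : G} (ha : a ∈ A) {x : ℝ} (hx : x ∈ bd S)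
    (hagree : ∀ n : ℕ, s.L (a ^ n) x = s.R (a ^ n) x) (hap : ∀ n : ℕ, 0 < n → s.R (a ^ n) x ≠ x) :
    False := by
  have hinj : Function.Injective (fun n : ℕ => s.R (a ^ n) x) := by
    have key : ∀ n m : ℕ, n < m → s.R (a ^ n) x ≠ s.R (a ^ m) x := by
      intro n m hnm h
      apply hap (m - n) (by omega)
      apply (s.R (a ^ n)).injective
      rw [← R_mul, ← pow_add, h]
      congr 3; omega
    intro n m h
    rcases lt_trichotomy n m with h1 | h1 | h1
    · exact absurd h (key _ _ h1)
    · exact h1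
    · exact absurd h.symm (key _ _ h1)
  apply Set.infinite_of_injective_forall_mem hinj (s := bd S) _ (hE.bd_finite hS)
  intro n
  have h1 := hI (a ^ n) (A.pow_mem ha n) x
  have h2 := hI.lft (A.pow_mem ha n) x
  show ¬ (s.R (a ^ n) x ∈ S ↔ s.R (a ^ n) x ∈ lft S)
  rw [h1, ← hagree, h2]
  exact hx

theorem aper_inv {ρ : G →* Equiv.Perm ℝ} {a : G} {x : ℝ} (hap : ∀ n : ℕ, 0 < n → ρ (a ^ n) x ≠ x)
    (n : ℕ) (hn : 0 < n) : ρ (a⁻¹ ^ n) x ≠ x := by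
  intro h
  apply hap n hn
  conv_lhs => rw [← h]
  rw [← Equiv.Perm.mul_apply, ← map_mul]
  simp

theorem conn_of_bd {A : Subgroup G} {S : Set ℝ} (hE : Elem S) (hS : S ⊆ Ico 0 1)
    (hI : s.Inv A S) {a : G} (ha : a ∈ A) {x : ℝ} (hx : x ∈ bd S)
    (hap : ∀ n : ℕ, 0 < n → s.L (a ^ n) x ≠ x) : x ∈ s.Conn a := by
  constructor
  · by_contra hc
    push Not at hc
    have hag := s.agree_of_L (a := a) (x := x) (fun n h => hc n (Or.inl h))
    exact s.orbit_contra hE hS hI ha hx hag (fun n hn => by rw [← hag]; exact hap n hn)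
  · by_contra hc
    push Not at hc
    have hag := s.agree_of_L (a := a⁻¹) (x := x) (fun n h => hc n (Or.inr h))
    exact s.orbit_contra hE hS hI (A.inv_mem ha) hx hag
      (fun n hn => by rw [← hag]; exact aper_inv hap n hn)

theorem connR_of_bd {A : Subgroup G} {S : Set ℝ} (hE : Elem S) (hS : S ⊆ Ico 0 1)
    (hI : s.Inv A S) {a : G} (ha : a ∈ A) {x : ℝ} (hx : x ∈ bd S)
    (hap : ∀ n : ℕ, 0 < n → s.R (a ^ n) x ≠ x) : x ∈ s.ConnR a := by
  constructor
  · by_contra hc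
    push Not at hc
    have hag := s.agree_of_R (a := a) (x := x) (fun n h => hc n (Or.inl h))
    exact s.orbit_contra hE hS hI ha hx hag hap
  · by_contra hc
    push Not at hc
    have hag := s.agree_of_R (a := a⁻¹) (x := x) (fun n h => hc n (Or.inr h))
    exact s.orbit_contra hE hS hI (A.inv_mem ha) hx hag (fun n hn => aper_inv hap n hn)

end Sys
end Ietx


namespace Ietx
namespace Sys

variable {G : Type*} [Group G] (s : Sys G)

theorem bd_moved_pow (a : G) (n : ℕ) : bd (s.moved (a ^ n)) ⊆ s.Conn a := by
  intro x hx
  have hx' : ¬ (s.R (a ^ n) x ≠ x ↔ s.L (a ^ n) x ≠ x) := by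
    rw [← lft_moved]; exact hx
  constructor
  · by_contra hc
    push Not at hc
    have hag := s.agree_of_L (a := a) (x := x) (fun n h => hc n (Or.inl h)) n
    rw [hag] at hx'
    exact hx' Iff.rfl
  · by_contra hc
    push Not at hc
    have hag := s.agree_of_L (a := a⁻¹) (x := x) (fun n h => hc n (Or.inr h)) n
    rw [inv_pow, map_inv, map_inv, Equiv.Perm.inv_eq_iff_eq] at hag
    apply hx'
    rw [not_iff_not]
    constructor
    · intro h
      have h2 : (s.R (a ^ n))⁻¹ x = x := by rw [Equiv.Perm.inv_eq_iff_eq, h]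
      rw [h2] at hag; exact hag.symm
    · intro h
      have h3 := hag.symm.trans h.symm
      have h2 := (s.L (a ^ n)).injective h3
      rw [Equiv.Perm.inv_eq_iff_eq] at h2
      exact h2.symm

theorem exists_aper {a : G} (ha : ¬ IsOfFinOrder a) :
    ∃ m : ℕ, (s.moved (a ^ m)).Nonempty ∧
      ∀ x ∈ s.moved (a ^ m), ∀ k : ℕ, 0 < k → s.R ((a ^ m) ^ k) x ≠ x := by
  have hfin : {S | ∃ n : ℕ, 0 < n ∧ S = s.moved (a ^ n)}.Finite := by
    apply finite_of_bd (s.Conn_finite a)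
    rintro S ⟨n, _, rfl⟩
    exact ⟨s.elem_moved _, s.moved_sub _, s.bd_moved_pow a n⟩
  obtain ⟨S, ⟨m, hm, rfl⟩, hmin⟩ := hfin.exists_minimal ⟨_, 1, one_pos, rfl⟩
  refine ⟨m, ?_, ?_⟩
  · by_contra hc
    apply ha
    rw [isOfFinOrder_iff_pow_eq_one]
    refine ⟨m, hm, s.inj _ fun x => ?_⟩
    by_contra hx
    exact hc ⟨x, hx⟩
  · intro x hx k hk
    rw [← pow_mul]
    have hsub : s.moved (a ^ (m * k)) ⊆ s.moved (a ^ m) := by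
      intro y hy hy2
      apply hy
      rw [pow_mul, map_pow]
      have : ∀ j : ℕ, (s.R (a ^ m) ^ j) y = y := by
        intro j
        induction j with
        | zero => simp
        | succ j ih => rw [pow_succ, Equiv.Perm.mul_apply, hy2, ih]
      exact this k
    exact hmin ⟨m * k, Nat.mul_pos hm hk, rfl⟩ hsub hx

/-- a finite partition into minimal invariant elementary sets -/
structure Atoms (A : Subgroup G) (N : Set (Set ℝ)) : Prop where
  fin : N.Finite
  elem : ∀ M ∈ N, Elem M
  sub : ∀ M ∈ N, M ⊆ Ico 0 1
  ne : ∀ M ∈ N, M.Nonempty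
  inv : ∀ M ∈ N, s.Inv A M
  min : ∀ M ∈ N, ∀ S, Elem S → s.Inv A S → (M ∩ S).Nonempty → M ⊆ S
  cover : ∀ x ∈ Ico (0:ℝ) 1, ∃ M ∈ N, x ∈ M
  pre : ∀ M ∈ N, ∀ g, s.R g ⁻¹' M ∈ N
  aper : ∀ M ∈ N, ∃ a ∈ A, ∀ x ∈ M, ∀ n : ℕ, 0 < n → s.R (a ^ n) x ≠ x

theorem exists_into {M : Set ℝ} (hE : Elem M) (hS : M ⊆ Ico 0 1) (hne : M.Nonempty)
    {x : ℝ} (hx : x ∈ Ico (0:ℝ) 1) : ∃ g, s.R g x ∈ M := by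
  obtain ⟨u, hu⟩ := hne
  obtain ⟨v, hv, hsub⟩ := hE.exists_Ioo hu
  obtain ⟨g, hg⟩ := s.dens x hx u (min v 1) (hS hu).1 (lt_min hv (hS hu).2) (min_le_right _ _)
  exact ⟨g, hsub ⟨hg.1, hg.2.trans_le (min_le_left _ _)⟩⟩

theorem exists_atoms {A : Subgroup G} [A.Normal] (hab : ∀ x ∈ A, ∀ y ∈ A, x * y = y * x)
    (ha : ∃ a ∈ A, ¬ IsOfFinOrder a) : ∃ N, s.Atoms A N := by
  obtain ⟨a₀, ha₀, hinf⟩ := ha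
  obtain ⟨m, hne, hap⟩ := s.exists_aper hinf
  set a := a₀ ^ m with ha_def
  have haA : a ∈ A := A.pow_mem ha₀ m
  set U := s.moved a with hU
  have hfin : {S | Elem S ∧ s.Inv A S ∧ S ⊆ U ∧ S.Nonempty}.Finite := by
    apply finite_of_bd ((s.Conn_finite a).union (s.ConnR_finite a))
    rintro S ⟨hE, hI, hSU, _⟩
    refine ⟨hE, hSU.trans (s.moved_sub _), fun x hx => ?_⟩
    by_cases hxS : x ∈ S
    · right
      exact s.connR_of_bd hE (hSU.trans (s.moved_sub _)) hI haA hx (hap x (hSU hxS))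
    · left
      have hxl : x ∈ lft S := by
        by_contra hc
        exact hx (by simp [hxS, hc])
      refine s.conn_of_bd hE (hSU.trans (s.moved_sub _)) hI haA hx (fun n hn h => ?_)
      obtain ⟨y, h1, h2⟩ := ((lft_ev hxl).and (s.hL (a ^ n) x)).exists
      apply hap y (hSU h1) n hn
      rw [h2, h]; ring
  obtain ⟨N, ⟨hE, hI, hNU, hNne⟩, hmin⟩ := hfin.exists_minimal
    ⟨U, s.elem_moved a, s.inv_moved (fun b hb => hab a haA b hb), subset_rfl, hne⟩
  have hNI : N ⊆ Ico 0 1 := hNU.trans (s.moved_sub _)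
  have hmin' : ∀ S, Elem S → s.Inv A S → (N ∩ S).Nonempty → N ⊆ S := by
    intro S h1 h2 h3
    exact (hmin (y := N ∩ S) ⟨hE.inter h1, hI.inter h2, inter_subset_left.trans hNU, h3⟩
      inter_subset_left).trans inter_subset_right
  have hmin2 : ∀ g, ∀ S, Elem S → s.Inv A S → (s.R g ⁻¹' N ∩ S).Nonempty → s.R g ⁻¹' N ⊆ S := by
    rintro g S h1 h2 ⟨x, hx1, hx2⟩ y hy
    have := hmin' (s.R g⁻¹ ⁻¹' S) (s.elem_preimage _ h1) (s.inv_gpreimage h2 _)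
      ⟨s.R g x, hx1, by rw [mem_preimage, ← R_mul]; simpa using hx2⟩ hy
    rw [mem_preimage, ← R_mul] at this
    simpa using this
  refine ⟨range (fun g => s.R g ⁻¹' N), ?_, ?_, ?_, ?_, ?_, ?_, ?_, ?_, ?_⟩
  · have hpos : 0 < volume N := by
      obtain ⟨u, hu⟩ := hNne
      obtain ⟨v, hv, hsub⟩ := hE.exists_Ioo hu
      refine lt_of_lt_of_le ?_ (measure_mono hsub)
      rw [Real.volume_Ioo]
      simpa using hv
    have := Measure.finite_const_le_meas_of_disjoint_iUnion (volume : Measure ℝ) hpos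
      (As := fun i : range (fun g => s.R g ⁻¹' N) => (i : Set ℝ)) ?_ ?_ ?_
    · have h2 : {i : range (fun g => s.R g ⁻¹' N) | volume N ≤ volume (i : Set ℝ)} = univ := by
        ext ⟨i, g, rfl⟩
        simp only [mem_ofPred_eq, mem_univ, iff_true]
        rw [(s.mp g).measure_preimage (hE.measurable hNI).nullMeasurableSet]
      rw [h2] at this
      exact Set.finite_coe_iff.1 (Set.finite_univ_iff.1 this)
    · rintro ⟨i, g, rfl⟩
      exact (s.elem_preimage g hE).measurable (s.preimage_Ico g hNI)
    · rintro ⟨i, g, rfl⟩ ⟨j, h, rfl⟩ hij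
      rw [Function.onFun, Set.disjoint_iff_inter_eq_empty]
      by_contra hc
      apply hij
      have hc := nonempty_iff_ne_empty.2 hc
      apply Subtype.ext
      apply Subset.antisymm
      · exact hmin2 g _ (s.elem_preimage h hE) (s.inv_gpreimage hI h) hc
      · exact hmin2 h _ (s.elem_preimage g hE) (s.inv_gpreimage hI g) (by rwa [inter_comm] at hc)
    · refine ne_top_of_le_ne_top (b := volume (Ico (0:ℝ) 1)) (by simp) (measure_mono ?_)
      refine iUnion_subset ?_
      rintro ⟨i, g, rfl⟩
      exact s.preimage_Ico g hNI
  · rintro _ ⟨g, rfl⟩; exact s.elem_preimage g hE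
  · rintro _ ⟨g, rfl⟩; exact s.preimage_Ico g hNI
  · rintro _ ⟨g, rfl⟩; exact hNne.preimage (s.R g).surjective
  · rintro _ ⟨g, rfl⟩; exact s.inv_gpreimage hI g
  · rintro _ ⟨g, rfl⟩; exact hmin2 g
  · intro x hx
    obtain ⟨g, hg⟩ := s.exists_into hE hNI hNne hx
    exact ⟨_, ⟨g, rfl⟩, hg⟩
  · rintro _ ⟨g, rfl⟩ h
    refine ⟨g * h, ?_⟩
    ext x; simp
  · rintro _ ⟨g, rfl⟩
    refine ⟨g⁻¹ * a * g, ?_, ?_⟩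
    · simpa using Subgroup.Normal.conj_mem (inferInstance : A.Normal) a haA g⁻¹
    · intro x hx n hn h
      apply hap (s.R g x) (hNU hx) n hn
      have h1 : (g⁻¹ * a * g) ^ n = g⁻¹ * a ^ n * g := by
        have := conj_pow (i := n) (a := g⁻¹) (b := a)
        rwa [inv_inv] at this
      rw [h1, mul_assoc, R_mul, map_inv, Equiv.Perm.inv_eq_iff_eq, R_mul] at h
      exact h

namespace Atoms
variable {s}
variable {A : Subgroup G} {N : Set (Set ℝ)} (hN : s.Atoms A N)
include hN

theorem eq_of_inter {M M' : Set ℝ} (h : M ∈ N) (h' : M' ∈ N) (hi : (M ∩ M').Nonempty) : M = M' :=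
  Subset.antisymm (hN.min M h M' (hN.elem _ h') (hN.inv _ h') hi)
    (hN.min M' h' M (hN.elem _ h) (hN.inv _ h) (by rwa [inter_comm]))

theorem cover_left {x : ℝ} (hx : x ∈ Ioc (0:ℝ) 1) : ∃ M ∈ N, x ∈ lft M := by
  by_contra hc
  push Not at hc
  have h1 : ∀ M ∈ N, ∀ᶠ y in 𝓝[<] x, y ∉ M := by
    intro M hM
    filter_upwards [(hN.elem M hM).ev_left x] with y hy
    rw [hy]; exact hc M hM
  have h2 := (hN.fin.eventually_all).2 h1
  obtain ⟨y, h3, h4⟩ := (h2.and (Ioo_mem_nhdsLT hx.1)).exists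
  obtain ⟨M, hM, hy⟩ := hN.cover y ⟨h4.1.le, h4.2.trans_le hx.2⟩
  exact h3 M hM hy

/-- freeness on right germs -/
theorem free_R {c : G} (hc : ∀ b ∈ A, c * b = b * c) {M : Set ℝ} (hM : M ∈ N) {x : ℝ}
    (hx : x ∈ M) (h : s.R c x = x) : ∀ y ∈ M, s.R c y = y := by
  have := hN.min M hM _ (s.elem_moved c).compl (s.inv_moved hc).compl ⟨x, hx, fun h' => h' h⟩
  intro y hy
  by_contra hne
  exact this hy hne

theorem free_L {c : G} (hc : ∀ b ∈ A, c * b = b * c) {M : Set ℝ} (hM : M ∈ N) {x : ℝ}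
    (hx : x ∈ lft M) (h : s.L c x = x) : ∀ y ∈ M, s.R c y = y := by
  obtain ⟨y, h1, h2⟩ := ((lft_ev hx).and (s.hL c x)).exists
  exact hN.free_R hc hM h1 (by rw [h2, h]; ring)

omit hN in
theorem aper_L {M : Set ℝ} {a : G} (ha : ∀ x ∈ M, ∀ n : ℕ, 0 < n → s.R (a ^ n) x ≠ x) {x : ℝ}
    (hx : x ∈ lft M) (n : ℕ) (hn : 0 < n) : s.L (a ^ n) x ≠ x := by
  intro h
  obtain ⟨y, h1, h2⟩ := ((lft_ev hx).and (s.hL (a ^ n) x)).exists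
  exact ha y h1 n hn (by rw [h2, h]; ring)

end Atoms
end Sys
end Ietx


namespace Ietx
namespace Sys

variable {G : Type*} [Group G] (s : Sys G)

/-- `y` is the continuation of the left germ `x` along its `A`-orbit -/
def Good (A : Subgroup G) (x y : ℝ) : Prop := {z | ∃ b ∈ A, s.L b x = z ∧ z ≠ s.R b y}.Finite

theorem orb_inj {ρ : G →* Equiv.Perm ℝ} {a : G} {x : ℝ}
    (hap : ∀ n : ℕ, 0 < n → ρ (a ^ n) x ≠ x) : Function.Injective (fun n : ℕ => ρ (a ^ n) x) := by
  have key : ∀ n m : ℕ, n < m → ρ (a ^ n) x ≠ ρ (a ^ m) x := by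
    intro n m hnm h
    apply hap (m - n) (by omega)
    apply (ρ (a ^ n)).injective
    rw [← Equiv.Perm.mul_apply, ← map_mul, ← pow_add, h]
    congr 3; omega
  intro n m h
  rcases lt_trichotomy n m with h1 | h1 | h1
  · exact absurd h (key _ _ h1)
  · exact h1
  · exact absurd h.symm (key _ _ h1)

variable {s}

theorem Good.pow {A : Subgroup G} {x y : ℝ} (h : s.Good A x y) {a : G} (ha : a ∈ A)
    (hap : ∀ n : ℕ, 0 < n → s.L (a ^ n) x ≠ x) :
    ∀ᶠ n : ℕ in cofinite, s.L (a ^ n) x = s.R (a ^ n) y := by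
  rw [eventually_cofinite]
  refine (h.preimage (orb_inj hap).injOn).subset ?_
  intro n hn
  exact ⟨a ^ n, A.pow_mem ha n, rfl, hn⟩

theorem ev_avoid {a : G} {x : ℝ} (hap : ∀ n : ℕ, 0 < n → s.L (a ^ n) x ≠ x) {F : Set ℝ}
    (hF : F.Finite) : ∀ᶠ n : ℕ in cofinite, s.L (a ^ n) x ∉ F := by
  rw [eventually_cofinite]
  refine (hF.preimage (orb_inj hap).injOn).subset ?_
  intro n hn
  simpa using hn

theorem Good.conn {A : Subgroup G} {x y : ℝ} (h : s.Good A x y) {a : G} (ha : a ∈ A)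
    (hap : ∀ n : ℕ, 0 < n → s.L (a ^ n) x ≠ x) (hne : x ≠ y) : x ∈ s.Conn a := by
  obtain ⟨n, hn⟩ := (h.pow ha hap).exists
  obtain ⟨m, hm⟩ := (h.pow (A.inv_mem ha) (aper_inv hap)).exists
  exact s.conn_of_ne hne n m hn hm

theorem Good.conj {A : Subgroup G} [hA : A.Normal] {x y : ℝ} (h : s.Good A x y) (g : G) :
    s.Good A (s.L g x) (s.R g y) := by
  refine ((h.image (s.L g)).union ((s.D_finite g).image (s.L g))).subset ?_
  rintro z ⟨b, hb, rfl, hne⟩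
  have hb' : g⁻¹ * b * g ∈ A := by simpa using hA.conj_mem b hb g⁻¹
  have e1 : s.L b (s.L g x) = s.L g (s.L (g⁻¹ * b * g) x) := by
    rw [← L_mul, ← L_mul]; congr 2; group
  have e2 : s.R b (s.R g y) = s.R g (s.R (g⁻¹ * b * g) y) := by
    rw [← R_mul, ← R_mul]; congr 2; group
  rw [e1, e2] at hne
  rw [e1]
  by_cases hD : s.L (g⁻¹ * b * g) x ∈ s.D g
  · right; exact ⟨_, hD, rfl⟩
  · left
    refine ⟨_, ⟨_, hb', rfl, fun h => hne ?_⟩, rfl⟩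
    rw [s.not_mem_D.1 hD, h]

namespace Atoms
variable {A : Subgroup G} {N : Set (Set ℝ)} (hN : s.Atoms A N)
include hN

theorem good_unique {x y y' : ℝ} (hx : x ∈ Ioc (0:ℝ) 1) (h : s.Good A x y) (h' : s.Good A x y') :
    y = y' := by
  obtain ⟨M, hM, hxM⟩ := hN.cover_left hx
  obtain ⟨a, ha, hap⟩ := hN.aper M hM
  have hapL := aper_L hap hxM
  obtain ⟨n, h1, h2⟩ := ((h.pow ha hapL).and (h'.pow ha hapL)).exists
  exact (s.R (a ^ n)).injective (h1.symm.trans h2)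

theorem good_mem {x y : ℝ} {M : Set ℝ} (hM : M ∈ N) (hxM : x ∈ lft M) (h : s.Good A x y) :
    y ∈ M := by
  obtain ⟨a, ha, hap⟩ := hN.aper M hM
  have hapL := aper_L hap hxM
  obtain ⟨n, h1, h2⟩ := ((h.pow ha hapL).and
    (ev_avoid hapL ((hN.elem M hM).bd_finite (hN.sub M hM)))).exists
  have hm := A.pow_mem ha n
  have h3 := ((hN.inv M hM).lft hm x).2 hxM
  have h4 : s.L (a ^ n) x ∈ M := by
    by_contra hc
    exact h2 (fun h => hc (h.2 h3))
  rw [h1] at h4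
  exact (hN.inv M hM _ hm y).1 h4

theorem good_inj {x x' y : ℝ} (hx : x ∈ Ioc (0:ℝ) 1) (hx' : x' ∈ Ioc (0:ℝ) 1)
    (h : s.Good A x y) (h' : s.Good A x' y) : x = x' := by
  obtain ⟨M, hM, hxM⟩ := hN.cover_left hx
  obtain ⟨M', hM', hxM'⟩ := hN.cover_left hx'
  have := hN.eq_of_inter hM hM' ⟨y, hN.good_mem hM hxM h, hN.good_mem hM' hxM' h'⟩
  subst this
  obtain ⟨a, ha, hap⟩ := hN.aper M hM
  obtain ⟨n, h1, h2⟩ := ((h.pow ha (aper_L hap hxM)).and (h'.pow ha (aper_L hap hxM'))).exists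
  exact (s.L (a ^ n)).injective (h1.trans h2.symm)

/-- If some translate of `x` has an `a`-orbit without discontinuities then `x` is good. -/
theorem exists_good (hab : ∀ x ∈ A, ∀ y ∈ A, x * y = y * x) {x : ℝ} {M : Set ℝ} (hM : M ∈ N)
    (hxM : x ∈ lft M) {a : G} (ha : a ∈ A)
    (hap : ∀ x ∈ M, ∀ n : ℕ, 0 < n → s.R (a ^ n) x ≠ x) {b₀ : G} (hb₀ : b₀ ∈ A)
    (h1 : ∀ n : ℕ, s.L (a ^ n) (s.L b₀ x) ∉ s.Dd a)
    (h2 : ∀ n : ℕ, s.L (a⁻¹ ^ n) (s.L b₀ x) ∉ s.Dd a) : ∃ y, s.Good A x y := by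
  set w := s.L b₀ x with hw
  have hwM : w ∈ lft M := ((hN.inv M hM).lft hb₀ x).2 hxM
  have hag1 := s.agree_of_L (a := a) (x := w) (fun n h => h1 n (Or.inl h))
  have hag2 := s.agree_of_L (a := a⁻¹) (x := w) (fun n h => h2 n (Or.inr h))
  refine ⟨s.R b₀⁻¹ w, (s.Conn_finite a).subset ?_⟩
  rintro z ⟨b, hb, rfl, hne⟩
  have hd : b * b₀⁻¹ ∈ A := A.mul_mem hb (A.inv_mem hb₀)
  have e1 : s.L b x = s.L (b * b₀⁻¹) w := by
    rw [hw, ← L_mul]; congr 2; group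
  rw [e1] at hne ⊢
  rw [← R_mul] at hne
  have key : ∀ a' ∈ A, (∀ n : ℕ, 0 < n → s.L (a' ^ n) w ≠ w) →
      (∀ n : ℕ, s.L (a' ^ n) w = s.R (a' ^ n) w) →
      ∃ n : ℕ, s.L (a' ^ n) (s.L (b * b₀⁻¹) w) = s.R (a' ^ n) (s.R (b * b₀⁻¹) w) := by
    intro a' ha' hap' hag'
    obtain ⟨n, hn⟩ := (ev_avoid hap' (s.D_finite (b * b₀⁻¹))).exists
    refine ⟨n, ?_⟩
    rw [← L_mul, ← R_mul, hab _ (A.pow_mem ha' n) _ hd, L_mul, R_mul, s.not_mem_D.1 hn, hag']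
  obtain ⟨n, hn⟩ := key a ha (aper_L hap hwM) hag1
  obtain ⟨m, hm⟩ := key a⁻¹ (A.inv_mem ha) (aper_inv (aper_L hap hwM)) hag2
  exact s.conn_of_ne hne n m hn hm

theorem exists_psi [A.Normal] (hgood : ∀ x ∈ Ioc (0:ℝ) 1, ∃ y, s.Good A x y) :
    ∃ ψ : ℝ → ℝ, (∀ x ∈ Ioc (0:ℝ) 1, ψ x ∈ Ico (0:ℝ) 1) ∧
      (∀ g, ∀ x ∈ Ioc (0:ℝ) 1, ψ (s.L g x) = s.R g (ψ x)) ∧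
      InjOn ψ (Ioc 0 1) ∧ {x | x ∈ Ioc (0:ℝ) 1 ∧ ψ x ≠ x}.Finite := by
  have : ∀ x, ∃ y, x ∈ Ioc (0:ℝ) 1 → s.Good A x y := by
    intro x
    by_cases hx : x ∈ Ioc (0:ℝ) 1
    · obtain ⟨y, hy⟩ := hgood x hx
      exact ⟨y, fun _ => hy⟩
    · exact ⟨0, fun h => absurd h hx⟩
  choose ψ hψ using this
  refine ⟨ψ, ?_, ?_, ?_, ?_⟩
  · intro x hx
    obtain ⟨M, hM, hxM⟩ := hN.cover_left hx
    exact hN.sub M hM (hN.good_mem hM hxM (hψ x hx))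
  · intro g x hx
    exact hN.good_unique (s.L_mem_Ioc hx) (hψ _ (s.L_mem_Ioc hx)) ((hψ x hx).conj g)
  · intro x hx x' hx' h
    exact hN.good_inj hx hx' (hψ x hx) (h ▸ hψ x' hx')
  · have hch : ∀ M, ∃ a, M ∈ N → a ∈ A ∧ ∀ x ∈ M, ∀ n : ℕ, 0 < n → s.R (a ^ n) x ≠ x := by
      intro M
      by_cases hM : M ∈ N
      · obtain ⟨a, h1, h2⟩ := hN.aper M hM
        exact ⟨a, fun _ => ⟨h1, h2⟩⟩
      · exact ⟨1, fun h => absurd h hM⟩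
    choose a ha using hch
    refine (hN.fin.biUnion (fun M _ => s.Conn_finite (a M))).subset ?_
    rintro x ⟨hx, hne⟩
    obtain ⟨M, hM, hxM⟩ := hN.cover_left hx
    simp only [mem_iUnion]
    exact ⟨M, hM, (hψ x hx).conn (ha M hM).1 (aper_L (ha M hM).2 hxM) (Ne.symm hne)⟩

end Atoms
end Sys
end Ietx


namespace Ietx

theorem finiteIndex_of_map {G : Type*} [Group G] (H : Subgroup G) {α : Type*} [Finite α]
    (f : G → α) (h : ∀ g g', f g = f g' → g⁻¹ * g' ∈ H) : H.FiniteIndex := by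
  have : Finite (G ⧸ H) := by
    apply Finite.of_injective (fun q : G ⧸ H => f q.out)
    intro q q' hq
    have := h _ _ hq
    rw [← QuotientGroup.eq] at this
    simpa using this
  exact Subgroup.finiteIndex_of_finite_quotient

theorem real_induction {d : ℝ} {P : ℝ → Prop} (h0 : P 0)
    (hr : ∀ t, 0 ≤ t → t < d → P t → ∀ᶠ r in 𝓝[>] (0:ℝ), P (t + r))
    (hl : ∀ t, 0 < t → t ≤ d → (∀ r, 0 ≤ r → r < t → P r) → P t) :
    ∀ t, 0 ≤ t → t ≤ d → P t := by
  by_contra hc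
  push Not at hc
  obtain ⟨t, ht0, htd, hPt⟩ := hc
  set B : Set ℝ := {t | 0 ≤ t ∧ t ≤ d ∧ ¬ P t} with hB
  have hBne : B.Nonempty := ⟨t, ht0, htd, hPt⟩
  have hbb : BddBelow B := ⟨0, fun x hx => hx.1⟩
  have hs0 : 0 ≤ sInf B := le_csInf hBne fun x hx => hx.1
  have hsd : sInf B ≤ d := (csInf_le hbb ⟨ht0, htd, hPt⟩).trans htd
  have hbelow : ∀ r, 0 ≤ r → r < sInf B → P r := by
    intro r h1 h2
    by_contra h3
    exact absurd (csInf_le hbb ⟨h1, h2.le.trans hsd, h3⟩) (not_le.2 h2)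
  have hPs : P (sInf B) := by
    rcases hs0.eq_or_lt with h | h
    · rw [← h]; exact h0
    · exact hl _ h hsd hbelow
  have hlt : sInf B < d := by
    refine lt_of_le_of_ne hsd fun h => ?_
    have : t = sInf B := le_antisymm (htd.trans h.ge) (csInf_le hbb ⟨ht0, htd, hPt⟩)
    exact hPt (this ▸ hPs)
  have h1 := hr _ hs0 hlt hPs
  rw [eventually_nhdsWithin_iff, Metric.eventually_nhds_iff] at h1
  obtain ⟨e, he, h2⟩ := h1
  obtain ⟨y, hy, hy2⟩ := exists_lt_of_csInf_lt hBne (show sInf B < sInf B + e by linarith)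
  have h3 : sInf B ≤ y := csInf_le hbb hy
  rcases h3.eq_or_lt with h4 | h4
  · exact hy.2.2 (h4 ▸ hPs)
  · have h5 := h2 (y := y - sInf B) (by rw [Real.dist_eq, abs_lt]; constructor <;> linarith)
      (mem_Ioi.2 (sub_pos.2 h4))
    rw [add_sub_cancel] at h5
    exact hy.2.2 h5

theorem exists_gap {P : Set ℝ} (hP : P.Finite) :
    ∃ d > 0, ∀ p ∈ P, ∀ q ∈ P, p < q → d < q - p := by
  have hfin : ((fun z : ℝ × ℝ => z.2 - z.1) '' (P ×ˢ P)).Finite := (hP.prod hP).image _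
  have hpos : ∀ᶠ d in 𝓝[>] (0:ℝ), ∀ e ∈ ((fun z : ℝ × ℝ => z.2 - z.1) '' (P ×ˢ P)), 0 < e → d < e := by
    refine (hfin.eventually_all).2 ?_
    intro e _
    by_cases he : 0 < e
    · filter_upwards [Ioo_mem_nhdsGT he] with d hd _
      exact hd.2
    · exact Eventually.of_forall fun _ h => absurd h he
  obtain ⟨d, h1, h2⟩ := (hpos.and self_mem_nhdsWithin).exists
  exact ⟨d, h2, fun p hp q hq hpq => h1 _ ⟨(p, q), ⟨hp, hq⟩, rfl⟩ (sub_pos.2 hpq)⟩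

open Classical in
/-- the flow obtained by gluing through `ψ` -/
noncomputable def flow (ψ : ℝ → ℝ) (Q : Set ℝ) (t x : ℝ) : ℝ :=
  if x ∈ Ico (0:ℝ) 1 then
    if h : ∃ q ∈ Q, x < q ∧ q ≤ x + t then ψ h.choose + (x + t - h.choose) else x + t
  else x

/-- data for the flow -/
structure FlowData (ψ : ℝ → ℝ) (Q : Set ℝ) (d : ℝ) : Prop where
  dpos : 0 < d
  fin : Q.Finite
  mem : ∀ x ∈ Ioc (0:ℝ) 1, ψ x ∈ Ico (0:ℝ) 1
  inj : InjOn ψ (Ioc 0 1)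
  hQ : ∀ x, x ∈ Q ↔ x ∈ Ioc (0:ℝ) 1 ∧ ψ x ≠ x
  gap : ∀ p ∈ Q ∪ ψ '' Q, ∀ q ∈ Q ∪ ψ '' Q, p < q → d < q - p

namespace FlowData
variable {ψ : ℝ → ℝ} {Q : Set ℝ} {d : ℝ} (hF : FlowData ψ Q d)
include hF

theorem one_mem : (1:ℝ) ∈ Q := by
  rw [hF.hQ]
  refine ⟨by simp, fun h => ?_⟩
  have := (hF.mem 1 (by simp)).2
  linarith

theorem memIoc {q : ℝ} (hq : q ∈ Q) : q ∈ Ioc (0:ℝ) 1 := ((hF.hQ q).1 hq).1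

omit hF in
theorem flow_out {x t : ℝ} (hx : x ∉ Ico (0:ℝ) 1) : flow ψ Q t x = x := by
  simp only [flow, if_neg hx]

omit hF in
theorem flow_no {x t : ℝ} (hx : x ∈ Ico (0:ℝ) 1) (h : ∀ q ∈ Q, x < q → x + t < q) :
    flow ψ Q t x = x + t := by
  have : ¬ ∃ q ∈ Q, x < q ∧ q ≤ x + t := by
    rintro ⟨q, h1, h2, h3⟩
    have := h q h1 h2
    linarith
  simp only [flow, if_pos hx, dif_neg this]

theorem flow_jump {x t q : ℝ} (hx : x ∈ Ico (0:ℝ) 1) (ht : t ≤ d) (hq : q ∈ Q) (h1 : x < q)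
    (h2 : q ≤ x + t) : flow ψ Q t x = ψ q + (x + t - q) := by
  have h : ∃ q ∈ Q, x < q ∧ q ≤ x + t := ⟨q, hq, h1, h2⟩
  have : h.choose = q := by
    obtain ⟨h3, h4, h5⟩ := h.choose_spec
    rcases lt_trichotomy h.choose q with h6 | h6 | h6
    · have := hF.gap _ (Or.inl h3) _ (Or.inl hq) h6
      linarith
    · exact h6
    · have := hF.gap _ (Or.inl hq) _ (Or.inl h3) h6
      linarith
  simp only [flow, if_pos hx, dif_pos h, this]

omit hF in
theorem cases (x t : ℝ) : (∃ q ∈ Q, x < q ∧ q ≤ x + t) ∨ ∀ q ∈ Q, x < q → x + t < q := by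
  by_cases h : ∃ q ∈ Q, x < q ∧ q ≤ x + t
  · exact Or.inl h
  · right
    intro q hq h1
    by_contra hc
    exact h ⟨q, hq, h1, not_lt.1 hc⟩

/-- no point of `Q` shortly after `ψ q` -/
theorem after {q q' : ℝ} (hq : q ∈ Q) (hq' : q' ∈ Q) (h : ψ q < q') : d < q' - ψ q :=
  hF.gap _ (Or.inr ⟨q, hq, rfl⟩) _ (Or.inl hq') h

theorem flow_mem {x t : ℝ} (hx : x ∈ Ico (0:ℝ) 1) (ht0 : 0 ≤ t) (ht : t ≤ d) :
    flow ψ Q t x ∈ Ico (0:ℝ) 1 := by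
  rcases cases (Q := Q) x t with ⟨q, hq, h1, h2⟩ | h
  · rw [hF.flow_jump hx ht hq h1 h2]
    have h3 := hF.mem q (hF.memIoc hq)
    have h4 := hF.after hq hF.one_mem h3.2
    exact ⟨by have := h3.1; linarith, by linarith⟩
  · rw [flow_no hx h]
    exact ⟨by have := hx.1; linarith, h 1 hF.one_mem hx.2⟩

theorem flow_add {x t r : ℝ} (hr0 : 0 ≤ r) (ht0 : 0 ≤ t) (hrt : r + t ≤ d) :
    flow ψ Q r (flow ψ Q t x) = flow ψ Q (r + t) x := by
  by_cases hx : x ∈ Ico (0:ℝ) 1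
  swap
  · rw [flow_out hx, flow_out hx, flow_out hx]
  have hm := hF.flow_mem hx ht0 (by linarith)
  rcases cases (Q := Q) x t with ⟨q, hq, h1, h2⟩ | h
  · rw [hF.flow_jump hx (by linarith) hq h1 h2] at hm ⊢
    rw [hF.flow_jump hx hrt hq h1 (by linarith), flow_no hm]
    · ring
    · intro q' hq' h3
      have := hF.after hq hq' (by linarith)
      linarith
  · rw [flow_no hx h] at hm ⊢
    rcases cases (Q := Q) x (r + t) with ⟨q, hq, h1, h2⟩ | h'
    · rw [hF.flow_jump hx hrt hq h1 h2, hF.flow_jump hm (by linarith) hq (h q hq h1) (by linarith)]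
      ring
    · rw [flow_no hx h', flow_no hm]
      · ring
      · intro q hq h1
        have := h' q hq (by linarith)
        linarith

theorem flow_small {x : ℝ} (hx : x ∈ Ico (0:ℝ) 1) :
    ∀ᶠ r in 𝓝[>] (0:ℝ), flow ψ Q r x = x + r := by
  have : ∀ᶠ r in 𝓝[>] (0:ℝ), ∀ q ∈ Q, x < q → x + r < q := by
    refine (hF.fin.eventually_all).2 ?_
    intro q _
    by_cases h : x < q
    · filter_upwards [Ioo_mem_nhdsGT (show 0 < q - x by linarith)] with r hr _
      have := hr.2
      linarith
    · exact Eventually.of_forall fun _ h' => absurd h' h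
  filter_upwards [this] with r hr
  exact flow_no hx hr

theorem psi_eq {p : ℝ} (hp : p ∈ Ioc (0:ℝ) 1) (h : p ∉ Q) : ψ p = p := by
  by_contra hc
  exact h ((hF.hQ p).2 ⟨hp, hc⟩)

theorem flow_left {x t : ℝ} (hx : x ∈ Ico (0:ℝ) 1) (ht0 : 0 < t) (ht : t ≤ d) :
    ∃ p ∈ Ioc (0:ℝ) 1, flow ψ Q t x = ψ p ∧ ∀ᶠ r in 𝓝[>] (0:ℝ), flow ψ Q (t - r) x = p - r := by
  have hm := hF.flow_mem hx ht0.le ht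
  rcases cases (Q := Q) x t with ⟨q, hq, h1, h2⟩ | h
  · rcases h2.eq_or_lt with h3 | h3
    · refine ⟨q, hF.memIoc hq, ?_, ?_⟩
      · rw [hF.flow_jump hx ht hq h1 h2, ← h3]; ring
      · filter_upwards [Ioo_mem_nhdsGT ht0] with r hr
        have hr1 : 0 < r := hr.1
        have hr2 := hr.2
        rw [flow_no hx]
        · linarith
        · intro q' hq' h4
          by_contra hc
          have := hF.gap _ (Or.inl hq') _ (Or.inl hq) (by linarith)
          linarith
    · rw [hF.flow_jump hx ht hq h1 h2] at hm ⊢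
      have h4 := (hF.mem q (hF.memIoc hq)).1
      have hp : ψ q + (x + t - q) ∈ Ioc (0:ℝ) 1 := ⟨by linarith, hm.2.le⟩
      refine ⟨ψ q + (x + t - q), hp, ?_, ?_⟩
      · rw [hF.psi_eq hp]
        intro hc
        have := hF.after hq hc (by linarith)
        linarith
      · filter_upwards [Ioo_mem_nhdsGT (show 0 < x + t - q by linarith)] with r hr
        have hr1 : 0 < r := hr.1
        have hr2 := hr.2
        rw [hF.flow_jump hx (by linarith) hq h1 (by linarith)]
        ring
  · rw [flow_no hx h] at hm ⊢
    have hp : x + t ∈ Ioc (0:ℝ) 1 := ⟨by have := hx.1; linarith, hm.2.le⟩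
    refine ⟨x + t, hp, ?_, ?_⟩
    · rw [hF.psi_eq hp]
      intro hc
      have := h _ hc (by linarith)
      linarith
    · filter_upwards [Ioo_mem_nhdsGT ht0] with r hr
      have hr1 : 0 < r := hr.1
      rw [flow_no hx]
      · ring
      · intro q hq h1
        have := h q hq h1
        linarith

theorem flow_inj {t : ℝ} (ht0 : 0 ≤ t) (ht : t ≤ d) : Function.Injective (flow ψ Q t) := by
  have aux : ∀ x ∈ Ico (0:ℝ) 1, ∀ x' ∈ Ico (0:ℝ) 1, ∀ q ∈ Q, x < q → q ≤ x + t →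
      (∀ q ∈ Q, x' < q → x' + t < q) → x' + t = ψ q + (x + t - q) → False := by
    intro x hx x' hx' q hq h1 h2 h3 he
    have hw : ψ q ∉ Q := fun hc => by
      have := h3 _ hc (by linarith)
      linarith
    have hq2 := hF.mem q (hF.memIoc hq)
    have hwI : ψ q ∈ Ioc (0:ℝ) 1 := ⟨by have := hx'.1; linarith, hq2.2.le⟩
    have := hF.inj hwI (hF.memIoc hq) (hF.psi_eq hwI hw)
    rw [this] at hw
    exact hw hq
  intro x x' he
  by_cases hx : x ∈ Ico (0:ℝ) 1
  · by_cases hx' : x' ∈ Ico (0:ℝ) 1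
    · rcases cases (Q := Q) x t with ⟨q, hq, h1, h2⟩ | h
      · rcases cases (Q := Q) x' t with ⟨q', hq', h1', h2'⟩ | h'
        · rw [hF.flow_jump hx ht hq h1 h2, hF.flow_jump hx' ht hq' h1' h2'] at he
          have hqq : ψ q = ψ q' := by
            rcases lt_trichotomy (ψ q) (ψ q') with h | h | h
            · have := hF.gap _ (Or.inr ⟨q, hq, rfl⟩) _ (Or.inr ⟨q', hq', rfl⟩) h
              linarith
            · exact h
            · have := hF.gap _ (Or.inr ⟨q', hq', rfl⟩) _ (Or.inr ⟨q, hq, rfl⟩) h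
              linarith
          have := hF.inj (hF.memIoc hq) (hF.memIoc hq') hqq
          subst this
          linarith
        · rw [hF.flow_jump hx ht hq h1 h2, flow_no hx' h'] at he
          exact (aux x hx x' hx' q hq h1 h2 h' he.symm).elim
      · rcases cases (Q := Q) x' t with ⟨q', hq', h1', h2'⟩ | h'
        · rw [hF.flow_jump hx' ht hq' h1' h2', flow_no hx h] at he
          exact (aux x' hx' x hx q' hq' h1' h2' h he).elim
        · rw [flow_no hx h, flow_no hx' h'] at he
          linarith
    · rw [flow_out hx'] at he
      exact absurd (he ▸ hF.flow_mem hx ht0 ht) hx'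
  · by_cases hx' : x' ∈ Ico (0:ℝ) 1
    · rw [flow_out hx] at he
      exact absurd (he ▸ hF.flow_mem hx' ht0 ht) hx
    · rwa [flow_out hx, flow_out hx'] at he

theorem flow_comm_R {G : Type*} [Group G] (s : Sys G)
    (heq : ∀ g, ∀ x ∈ Ioc (0:ℝ) 1, ψ (s.L g x) = s.R g (ψ x)) (g : G) (x : ℝ) :
    ∀ t, 0 ≤ t → t ≤ d → s.R g (flow ψ Q t x) = flow ψ Q t (s.R g x) := by
  by_cases hx : x ∈ Ico (0:ℝ) 1
  swap
  · intro t _ _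
    rw [flow_out hx, s.out g x hx, flow_out hx]
  have hgx : s.R g x ∈ Ico (0:ℝ) 1 := s.R_mem_Ico hx
  have toR : ∀ {p : ℝ → Prop} {z : ℝ}, (∀ᶠ y in 𝓝[>] z, p y) → ∀ᶠ r in 𝓝[>] (0:ℝ), p (z + r) := by
    intro p z h
    rw [eventually_nhdsWithin_iff, Metric.eventually_nhds_iff] at h ⊢
    obtain ⟨e, he, h⟩ := h
    refine ⟨e, he, fun r hr hr0 => h (by simpa [Real.dist_eq] using hr) ?_⟩
    have hr0 : 0 < r := hr0
    show z < z + r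
    linarith
  have toL : ∀ {p : ℝ → Prop} {z : ℝ}, (∀ᶠ y in 𝓝[<] z, p y) → ∀ᶠ r in 𝓝[>] (0:ℝ), p (z - r) := by
    intro p z h
    rw [eventually_nhdsWithin_iff, Metric.eventually_nhds_iff] at h ⊢
    obtain ⟨e, he, h⟩ := h
    refine ⟨e, he, fun r hr hr0 => h (by simpa [Real.dist_eq] using hr) ?_⟩
    have hr0 : 0 < r := hr0
    show z - r < z
    linarith
  apply real_induction
  · have h0 : ∀ z ∈ Ico (0:ℝ) 1, flow ψ Q 0 z = z := fun z hz => by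
      rw [flow_no hz] <;> simp
    rw [h0 x hx, h0 _ hgx]
  · intro t ht0 htd hP
    have hm := hF.flow_mem hx ht0 htd.le
    filter_upwards [hF.flow_small hm, hF.flow_small (s.R_mem_Ico (g := g) hm),
      toR (s.hR g (flow ψ Q t x)), Ioo_mem_nhdsGT (show 0 < d - t by linarith)] with r h1 h2 h3 h4
    have h40 := h4.1
    have h41 := h4.2
    rw [add_comm t r, ← hF.flow_add h40.le ht0 (by linarith),
      ← hF.flow_add h40.le ht0 (by linarith), ← hP, h1, h2, h3]
    ring
  · intro t ht0 htd hP
    obtain ⟨p, hp, h1, h2⟩ := hF.flow_left hx ht0 htd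
    obtain ⟨p', hp', h1', h2'⟩ := hF.flow_left hgx ht0 htd
    obtain ⟨r, h3, h3', h4, h5⟩ := (h2.and (h2'.and ((toL (s.hL g p)).and
      (Ioo_mem_nhdsGT ht0)))).exists
    have h50 := h5.1
    have h51 := h5.2
    have h6 := hP (t - r) (by linarith) (by linarith)
    rw [h3, h3', h4] at h6
    have h7 : p' = s.L g p := by linarith
    rw [h1, h1', h7, heq g p hp]

end FlowData

theorem abelian_of_psi {G : Type*} [Group G] (s : Sys G) {ψ : ℝ → ℝ}
    (hmem : ∀ x ∈ Ioc (0:ℝ) 1, ψ x ∈ Ico (0:ℝ) 1)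
    (heq : ∀ g, ∀ x ∈ Ioc (0:ℝ) 1, ψ (s.L g x) = s.R g (ψ x))
    (hinj : InjOn ψ (Ioc 0 1)) (hfin : {x | x ∈ Ioc (0:ℝ) 1 ∧ ψ x ≠ x}.Finite) :
    ∃ H : Subgroup G, H.FiniteIndex ∧ ∀ x ∈ H, ∀ y ∈ H, x * y = y * x := by
  set Q : Set ℝ := {x | x ∈ Ioc (0:ℝ) 1 ∧ ψ x ≠ x} with hQ
  obtain ⟨d, hd, hgap⟩ := exists_gap (hfin.union (hfin.image ψ))
  have hF : FlowData ψ Q d := ⟨hd, hfin, hmem, hinj, fun x => Iff.rfl, hgap⟩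
  set e := d / 2 with he
  have he0 : 0 < e := by rw [he]; linarith
  -- the commutative monoid generated by the flow
  set S : Set (Function.End ℝ) := {f | ∃ t, 0 ≤ t ∧ t ≤ e ∧ f = flow ψ Q t} with hS
  set 𝓜 := Submonoid.closure S with h𝓜
  have hcomm : ∀ m ∈ 𝓜, ∀ m' ∈ 𝓜, m * m' = m' * m := by
    have h1 : S ⊆ Submonoid.centralizer S := by
      rintro _ ⟨t, ht0, ht, rfl⟩
      refine Submonoid.mem_centralizer_iff.2 ?_
      rintro _ ⟨r, hr0, hr, rfl⟩
      funext x
      show flow ψ Q r (flow ψ Q t x) = flow ψ Q t (flow ψ Q r x)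
      rw [hF.flow_add hr0 ht0 (by linarith), hF.flow_add ht0 hr0 (by linarith), add_comm]
    have h2 : 𝓜 ≤ Submonoid.centralizer S := Submonoid.closure_le.2 h1
    have h3 : S ⊆ Submonoid.centralizer (𝓜 : Set (Function.End ℝ)) := by
      intro f hf
      rw [SetLike.mem_coe, Submonoid.mem_centralizer_iff]
      intro m hm
      exact ((Submonoid.mem_centralizer_iff).1 (h2 hm) f hf).symm
    have h4 : 𝓜 ≤ Submonoid.centralizer (𝓜 : Set (Function.End ℝ)) := Submonoid.closure_le.2 h3
    intro m hm m' hm'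
    exact (Submonoid.mem_centralizer_iff).1 (h4 hm') m hm
  have hminj : ∀ m ∈ 𝓜, Function.Injective m := by
    intro m hm
    induction hm using Submonoid.closure_induction with
    | mem f hf =>
      obtain ⟨t, ht0, ht, rfl⟩ := hf
      exact hF.flow_inj ht0 (by linarith)
    | one => exact Function.injective_id
    | mul f f' _ _ h1 h2 => exact h1.comp h2
  have hmR : ∀ m ∈ 𝓜, ∀ g x, s.R g (m x) = m (s.R g x) := by
    intro m hm
    induction hm using Submonoid.closure_induction with
    | mem f hf =>
      obtain ⟨t, ht0, ht, rfl⟩ := hf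
      intro g x
      exact hF.flow_comm_R s heq g x t ht0 (by linarith)
    | one => intro g x; rfl
    | mul f f' _ _ h1 h2 =>
      intro g x
      show s.R g (f (f' x)) = f (f' (s.R g x))
      rw [h1, h2]
  let rel : ℝ → ℝ → Prop := fun x y => ∃ m ∈ 𝓜, ∃ m' ∈ 𝓜, m x = m' y
  have rel_refl : ∀ x, rel x x := fun x => ⟨1, 𝓜.one_mem, 1, 𝓜.one_mem, rfl⟩
  have rel_symm : ∀ x y, rel x y → rel y x := fun x y ⟨m, hm, m', hm', h⟩ =>
    ⟨m', hm', m, hm, h.symm⟩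
  have rel_trans : ∀ x y z, rel x y → rel y z → rel x z := by
    rintro x y z ⟨m, hm, m', hm', h⟩ ⟨n, hn, n', hn', h'⟩
    refine ⟨n * m, 𝓜.mul_mem hn hm, m' * n', 𝓜.mul_mem hm' hn', ?_⟩
    show n (m x) = m' (n' z)
    rw [h, ← h']
    exact congrFun (hcomm n hn m' hm') y
  have rel_R : ∀ g x y, rel x y → rel (s.R g x) (s.R g y) := by
    rintro g x y ⟨m, hm, m', hm', h⟩
    exact ⟨m, hm, m', hm', by rw [← hmR m hm, ← hmR m' hm', h]⟩
  let H : Subgroup G :=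
    { carrier := {g | ∀ x, rel x (s.R g x)}
      one_mem' := fun x => by simpa using rel_refl x
      mul_mem' := by
        intro g h hg hh x
        rw [s.R_mul]
        exact rel_trans _ _ _ (hh x) (hg _)
      inv_mem' := by
        intro g hg x
        have := hg (s.R g⁻¹ x)
        rw [← s.R_mul, mul_inv_cancel] at this
        exact rel_symm _ _ (by simpa using this) }
  refine ⟨H, ?_, ?_⟩
  · let c : ℝ → ℤ × Set ℝ := fun x => (⌊x / e⌋, Q ∩ Iic x)
    have hc : ∀ x ∈ Ico (0:ℝ) 1, ∀ y ∈ Ico (0:ℝ) 1, c x = c y → rel x y := by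
      have aux : ∀ x ∈ Ico (0:ℝ) 1, ∀ y ∈ Ico (0:ℝ) 1, x ≤ y → c x = c y → rel x y := by
        intro x hx y hy hxy hcxy
        have h1 : ⌊x / e⌋ = ⌊y / e⌋ := congrArg Prod.fst hcxy
        have h2 : Q ∩ Iic x = Q ∩ Iic y := congrArg Prod.snd hcxy
        have h3 : y - x ≤ e := by
          have := Int.abs_sub_lt_one_of_floor_eq_floor h1
          rw [abs_lt, ← sub_div, lt_div_iff₀ he0] at this
          linarith [this.1]
        refine ⟨flow ψ Q (y - x), Submonoid.subset_closure ⟨_, by linarith, h3, rfl⟩, 1,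
          𝓜.one_mem, ?_⟩
        show flow ψ Q (y - x) x = y
        rw [FlowData.flow_no hx]
        · ring
        · intro q hq hxq
          by_contra hcc
          have : q ∈ Q ∩ Iic y := ⟨hq, by show q ≤ y; linarith⟩
          rw [← h2] at this
          have h5 : q ≤ x := this.2
          linarith
      intro x hx y hy h
      rcases le_total x y with h1 | h1
      · exact aux x hx y hy h1 h
      · exact rel_symm _ _ (aux y hy x hx h1 h.symm)
    have hTfin : (c '' Ico (0:ℝ) 1).Finite := by
      refine ((Set.finite_Icc (0:ℤ) ⌊1 / e⌋).prod hfin.finite_subsets).subset ?_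
      rintro _ ⟨x, hx, rfl⟩
      refine ⟨⟨Int.floor_nonneg.2 (div_nonneg hx.1 he0.le), Int.floor_le_floor ?_⟩,
        inter_subset_left⟩
      exact div_le_div_of_nonneg_right hx.2.le he0.le
    have : Finite (c '' Ico (0:ℝ) 1) := hTfin.to_subtype
    have hrep : ∀ k : c '' Ico (0:ℝ) 1, ∃ x ∈ Ico (0:ℝ) 1, c x = k := fun k => k.2
    choose rep hrep1 hrep2 using hrep
    apply finiteIndex_of_map H
      (f := fun g (k : c '' Ico (0:ℝ) 1) => (⟨c (s.R g (rep k)), _, s.R_mem_Ico (hrep1 k), rfl⟩ :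
        c '' Ico (0:ℝ) 1))
    intro g g' hgg x
    by_cases hx : x ∈ Ico (0:ℝ) 1
    swap
    · rw [s.out _ x hx]; exact rel_refl x
    set k : c '' Ico (0:ℝ) 1 := ⟨c x, x, hx, rfl⟩ with hk
    have h1 : c (s.R g (rep k)) = c (s.R g' (rep k)) := congrArg Subtype.val (congrFun hgg k)
    have h2 := hc _ (s.R_mem_Ico (hrep1 k)) _ (s.R_mem_Ico (hrep1 k)) h1
    have h3 : rel x (rep k) := hc _ hx _ (hrep1 k) (hrep2 k).symm
    have h4 : rel (s.R g x) (s.R g' x) :=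
      rel_trans _ _ _ (rel_R g _ _ h3) (rel_trans _ _ _ h2 (rel_symm _ _ (rel_R g' _ _ h3)))
    have h5 := rel_R g⁻¹ _ _ h4
    rw [← s.R_mul, ← s.R_mul, inv_mul_cancel] at h5
    simpa using h5
  · intro g hg h hh
    have key : ∀ x, s.R (g * h) x = s.R (h * g) x := by
      intro x
      obtain ⟨m, hm, m', hm', h1⟩ := hg x
      obtain ⟨n, hn, n', hn', h2⟩ := hh x
      -- h1 : m x = m' (g x),  h2 : n x = n' (h x)
      have c1 : ∀ a ∈ 𝓜, ∀ b ∈ 𝓜, ∀ z, a (b z) = b (a z) := fun a ha b hb z =>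
        congrFun (hcomm a ha b hb) z
      apply hminj m' hm'
      apply hminj n' hn'
      rw [s.R_mul, s.R_mul]
      calc n' (m' (s.R g (s.R h x))) = m' (s.R g (n' (s.R h x))) := by
            rw [c1 n' hn' m' hm', hmR n' hn']
        _ = m' (s.R g (n x)) := by rw [h2]
        _ = n (m' (s.R g x)) := by rw [hmR n hn, c1 n hn m' hm']
        _ = n (m x) := by rw [h1]
        _ = m (n x) := by rw [c1 n hn m hm]
        _ = m (n' (s.R h x)) := by rw [h2]
        _ = n' (s.R h (m x)) := by rw [c1 m hm n' hn', hmR m hm]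
        _ = n' (s.R h (m' (s.R g x))) := by rw [h1]
        _ = n' (m' (s.R h (s.R g x))) := by rw [hmR m' hm']
    have := s.inj ((h * g)⁻¹ * (g * h)) (fun x => by
      rw [s.R_mul, key x, ← s.R_mul]; simp)
    rw [inv_mul_eq_one] at this
    exact this.symm

end Ietx


namespace Ietx
namespace Sys
variable {G : Type*} [Group G] {s : Sys G}

theorem L_inv_eq {g : G} {x y : ℝ} (h : s.L g x = y) : s.L g⁻¹ y = x := by
  rw [← h, ← L_mul]; simp

theorem R_inv_eq {g : G} {x y : ℝ} (h : s.R g x = y) : s.R g⁻¹ y = x := by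
  rw [← h, ← R_mul]; simp

namespace Atoms

theorem bad_step {A : Subgroup G} {N : Set (Set ℝ)} (hN : s.Atoms A N)
    (hab : ∀ x ∈ A, ∀ y ∈ A, x * y = y * x) {x : ℝ} (hx : x ∈ Ioc (0:ℝ) 1)
    (hbad : ∀ y, ¬ s.Good A x y) :
    ∃ m : ℕ, 0 < m ∧ ∃ M ∈ N, ∃ a ∈ A, ∀ b ∈ A, ∃ i : ℤ, ∀ y ∈ M, s.R (b ^ m) y = s.R (a ^ i) y := by
  obtain ⟨M, hM, hxM⟩ := hN.cover_left hx
  obtain ⟨a, ha, hap⟩ := hN.aper M hM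
  have hmeet : ∀ b : A, ∃ n : ℤ, s.L (a ^ n * b) x ∈ s.Dd a := by
    intro b
    by_contra hc
    push Not at hc
    obtain ⟨y, hy⟩ := hN.exists_good hab hM hxM ha hap (b₀ := b) b.2 (fun n => by
      rw [← L_mul]; simpa using hc n) (fun n => by
      rw [← L_mul]; simpa using hc (-n))
    exact hbad y hy
  choose n hn using hmeet
  let S : Subgroup A :=
    { carrier := {b | ∃ n : ℤ, s.L (b : G) x = s.L (a ^ n) x}
      one_mem' := ⟨0, by simp⟩
      mul_mem' := by
        rintro b c ⟨n, hn⟩ ⟨k, hk⟩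
        refine ⟨n + k, ?_⟩
        rw [Subgroup.coe_mul, L_mul, hk, ← L_mul, hab _ b.2 _ (A.zpow_mem ha k), L_mul, hn, ← L_mul,
          ← zpow_add, add_comm]
      inv_mem' := by
        rintro b ⟨n, hn⟩
        refine ⟨-n, ?_⟩
        rw [Subgroup.coe_inv]
        apply L_inv_eq
        rw [← L_mul, hab _ b.2 _ (A.zpow_mem ha _), L_mul, hn, ← L_mul, ← zpow_add]
        simp }
  have hSn : S.Normal := ⟨fun b hb g => by
    have : g * b * g⁻¹ = b := by
      apply Subtype.ext
      have := hab _ g.2 _ b.2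
      simp only [Subgroup.coe_mul, Subgroup.coe_inv]
      rw [this]; group
    rwa [this]⟩
  have : Finite (s.Dd a) := (s.Dd_finite a)
  have hSf : S.FiniteIndex := by
    refine finiteIndex_of_map S (fun b => (⟨_, hn b⟩ : s.Dd a)) ?_
    intro b c hbc
    have h1 : s.L (a ^ n b * b) x = s.L (a ^ n c * c) x := congrArg Subtype.val hbc
    refine ⟨n b - n c, ?_⟩
    rw [Subgroup.coe_mul, Subgroup.coe_inv, L_mul]
    apply L_inv_eq
    have h2 : (b:G) * a ^ (n b - n c) = a ^ (- n c) * (a ^ n b * b) := by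
      rw [hab _ b.2 _ (A.zpow_mem ha _), ← mul_assoc, ← zpow_add]
      congr 2; ring
    rw [← L_mul, h2, L_mul, h1, ← L_mul, ← mul_assoc, ← zpow_add]
    simp
  refine ⟨S.index, Nat.pos_of_ne_zero hSf.index_ne_zero, M, hM, a, ha, fun b hb => ?_⟩
  obtain ⟨i, hi⟩ := S.pow_index_mem (⟨b, hb⟩ : A)
  refine ⟨i, fun y hy => ?_⟩
  have h3 := hN.free_L (c := (a ^ i)⁻¹ * b ^ S.index)
    (fun d hd => hab _ (A.mul_mem (A.inv_mem (A.zpow_mem ha _)) (A.pow_mem hb _)) _ hd) hM hxM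
    (by
      rw [L_mul]; apply L_inv_eq
      exact hi.symm) y hy
  rw [R_mul] at h3
  have := R_inv_eq h3
  rw [inv_inv] at this
  exact this.symm

theorem abs_comm {C : Type*} [CommGroup C] (K : Subgroup C) (d δ β γ a : C) (i i' j : ℤ)
    (h1 : d⁻¹ * a ^ i ∈ K) (h2 : δ⁻¹ * a ^ i' ∈ K) (h3 : β⁻¹ * a ^ j ∈ K) (h4 : β⁻¹ * γ ∈ K)
    (hper : ∀ t : ℤ, β ^ t ∈ K → t = 0)
    (hconj : d ^ j * β ^ (-i) ∈ K → δ ^ j * γ ^ (-i) ∈ K) : δ⁻¹ * d ∈ K := by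
  rw [← QuotientGroup.eq] at h1 h2 h3 h4 ⊢
  simp only [← QuotientGroup.eq_one_iff, QuotientGroup.mk_mul, QuotientGroup.mk_zpow] at *
  rw [← h4, h1, h2, h3, ← zpow_mul, ← zpow_mul, ← zpow_mul, ← zpow_add, ← zpow_add] at hconj
  have h5 := hconj (by rw [show i * j + j * -i = 0 by ring, zpow_zero])
  have h6 := hper (i' * j + j * -i) (by rw [h3, ← zpow_mul, mul_comm, zpow_mul, h5, one_zpow])
  have hj : j ≠ 0 := by
    rintro rfl
    have := hper 1 (by rw [h3]; simp)
    omega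
  have h7 : j * (i' - i) = 0 := by linarith
  have h8 : i' = i := by
    rcases mul_eq_zero.1 h7 with h | h
    · exact absurd h hj
    · omega
  rw [h1, h2, h8]

def stabA (s : Sys G) (y : ℝ) : Subgroup G := (MulAction.stabilizer (Equiv.Perm ℝ) y).comap s.R

theorem mem_stabA {g : G} {y : ℝ} : g ∈ stabA s y ↔ s.R g y = y := Iff.rfl

theorem stabA_mul {g h : G} {y : ℝ} : g⁻¹ * h ∈ stabA s y ↔ s.R g y = s.R h y := by
  rw [mem_stabA, R_mul, map_inv, Equiv.Perm.inv_eq_iff_eq, eq_comm]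

theorem recur (a : G) {u x : ℝ} (hu : u < x) (hsub : Ioo u x ⊆ Ico (0:ℝ) 1) :
    ∃ y ∈ Ioo u x, ∃ k : ℕ, 0 < k ∧ s.R (a ^ k) y ∈ Ioo u x := by
  have hpre : s.R a ⁻¹' (Ico 0 1) = Ico 0 1 := by
    apply Subset.antisymm (s.preimage_Ico a subset_rfl)
    intro y hy
    exact s.R_mem_Ico hy
  have h1 := (s.mp a).restrict_preimage (measurableSet_Ico (a := (0:ℝ)) (b := 1))
  rw [hpre] at h1
  have : IsFiniteMeasure (volume.restrict (Ico (0:ℝ) 1)) := ⟨by simp⟩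
  obtain ⟨y, hy, k, hk, hm⟩ := h1.exists_mem_iterate_mem (s := Ioo u x)
    measurableSet_Ioo.nullMeasurableSet (by
      rw [Measure.restrict_eq_self _ hsub, Real.volume_Ioo]
      simpa using hu)
  refine ⟨y, hy, k, Nat.pos_of_ne_zero hk, ?_⟩
  rw [map_pow, Equiv.Perm.coe_pow]
  exact hm

theorem key {A B : Subgroup G} [hBn : B.Normal] {N : Set (Set ℝ)} (hN : s.Atoms B N) (hBA : B ≤ A)
    (hab : ∀ x ∈ A, ∀ y ∈ A, x * y = y * x)
    (hcyc : ∀ x ∈ Ico (0:ℝ) 1, ∃ a ∈ A, ∀ d ∈ B, ∃ i : ℤ, s.R d x = s.R (a ^ i) x)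
    {M : Set ℝ} (hM : M ∈ N) {x : ℝ} (hx : x ∈ lft M) {c : G} (hc : s.L c x = x)
    (hcM : s.R c ⁻¹' M = M) : ∀ y ∈ M, s.R c y = y := by
  have hev : ∀ᶠ y in 𝓝[<] x, y ∈ M ∧ s.R c y = y := by
    filter_upwards [lft_ev hx, s.hL c x] with y h1 h2
    refine ⟨h1, ?_⟩
    rw [h2, hc]; ring
  obtain ⟨u, hu, hsub⟩ := mem_nhdsLT_iff_exists_Ioo_subset.1 hev
  have hu : u < x := hu
  obtain ⟨a, ha, hap⟩ := hN.aper M hM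
  obtain ⟨y, hy, k, hk, hyk⟩ := recur (s := s) a hu (fun z hz => hN.sub M hM (hsub hz).1)
  obtain ⟨hyM, hcy⟩ := hsub hy
  obtain ⟨-, hcyk⟩ := hsub hyk
  have hcy' := R_inv_eq hcy
  -- elements of `A` agreeing at one point of `M`
  have hfree : ∀ e ∈ A, e ∈ stabA s y → ∀ z ∈ M, s.R e z = z := fun e he h =>
    hN.free_R (fun b hb => hab _ he _ (hBA hb)) hM hyM h
  have hfree2 : ∀ e ∈ A, ∀ f ∈ A, e⁻¹ * f ∈ stabA s y → ∀ z ∈ M, s.R e z = s.R f z := by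
    intro e he f hf h z hz
    have := hfree _ (A.mul_mem (A.inv_mem he) hf) h z hz
    rwa [← mem_stabA, stabA_mul] at this
  obtain ⟨a', ha', hcy2⟩ := hcyc y (hN.sub M hM hyM)
  have hcomm : ∀ d ∈ B, ∀ z ∈ M, s.R (c * d * c⁻¹) z = s.R d z := by
    intro d hd
    have hδ := hBn.conj_mem d hd c
    have hβ := B.pow_mem ha k
    have hγ := hBn.conj_mem _ hβ c
    apply hfree2 _ (hBA hδ) _ (hBA hd)
    obtain ⟨i, hi⟩ := hcy2 d hd
    obtain ⟨i', hi'⟩ := hcy2 _ hδ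
    obtain ⟨j, hj⟩ := hcy2 _ hβ
    let _ : CommGroup A := { (inferInstance : Group A) with
      mul_comm := fun p q => Subtype.ext (hab _ p.2 _ q.2) }
    refine abs_comm ((stabA s y).subgroupOf A) ⟨d, hBA hd⟩ ⟨_, hBA hδ⟩ ⟨_, hBA hβ⟩ ⟨_, hBA hγ⟩ ⟨a', ha'⟩
      i i' j (stabA_mul.2 hi) (stabA_mul.2 hi') (stabA_mul.2 hj) (stabA_mul.2 ?_) ?_ ?_
    · show s.R (a ^ k) y = s.R (c * a ^ k * c⁻¹) y
      rw [R_mul, R_mul, hcy', hcyk]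
    · intro t ht
      have ht : s.R ((a ^ k) ^ t) y = y := ht
      by_contra hne
      have h1 : (a ^ k) ^ (t.natAbs) ∈ stabA s y := by
        have ht : (a ^ k) ^ t ∈ stabA s y := ht
        rcases Int.natAbs_eq t with h | h
        · rw [h, zpow_natCast] at ht; exact ht
        · rw [h, zpow_neg, zpow_natCast, inv_mem_iff] at ht; exact ht
      rw [← pow_mul] at h1
      exact hap y hyM _ (Nat.mul_pos hk (Int.natAbs_pos.2 hne)) h1
    · intro h
      have h : d ^ j * (a ^ k) ^ (-i) ∈ stabA s y := h
      show (c * d * c⁻¹) ^ j * (c * a ^ k * c⁻¹) ^ (-i) ∈ stabA s y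
      rw [conj_zpow, conj_zpow, show c * d ^ j * c⁻¹ * (c * (a ^ k) ^ (-i) * c⁻¹) =
        c * (d ^ j * (a ^ k) ^ (-i)) * c⁻¹ by group, mem_stabA, R_mul, R_mul, hcy', mem_stabA.1 h, hcy]
  have hS : M ⊆ M ∩ (s.moved c)ᶜ := by
    refine hN.min M hM _ ((hN.elem M hM).inter (s.elem_moved c).compl) ?_
      ⟨y, hyM, hyM, fun h => h hcy⟩
    intro d hd z
    rw [mem_inter_iff, mem_inter_iff, hN.inv M hM d hd z]
    refine and_congr_right fun hz => ?_
    have hcz : s.R c z ∈ M := by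
      have : z ∈ s.R c ⁻¹' M := by rw [hcM]; exact hz
      exact this
    have h1 : s.R c (s.R d z) = s.R d (s.R c z) := by
      rw [← hcomm d hd _ hcz, ← R_mul, ← R_mul]; congr 2; group
    rw [mem_compl_iff, mem_compl_iff, mem_moved, mem_moved, h1, not_iff_not, not_iff_not]
    exact (s.R d).apply_eq_iff_eq
  intro z hz
  by_contra h
  exact (hS hz).2 h

theorem bad_abelian {A B : Subgroup G} [hBn : B.Normal] {N : Set (Set ℝ)} (hN : s.Atoms B N)
    (hBA : B ≤ A) (hab : ∀ x ∈ A, ∀ y ∈ A, x * y = y * x)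
    (hcyc : ∀ x ∈ Ico (0:ℝ) 1, ∃ a ∈ A, ∀ d ∈ B, ∃ i : ℤ, s.R d x = s.R (a ^ i) x)
    {x₀ : ℝ} (hx₀ : x₀ ∈ Ioc (0:ℝ) 1) (hbad : ∀ y, ¬ s.Good B x₀ y) :
    ∃ H : Subgroup G, H.FiniteIndex ∧ ∀ x ∈ H, ∀ y ∈ H, x * y = y * x := by
  have habB : ∀ x ∈ B, ∀ y ∈ B, x * y = y * x := fun x hx y hy => hab x (hBA hx) y (hBA hy)
  have hbadg : ∀ {x}, (∀ y, ¬ s.Good B x y) → ∀ g y, ¬ s.Good B (s.L g x) y := by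
    intro x hx g y hy
    have := hy.conj g⁻¹
    rw [L_inv_eq rfl] at this
    exact hx _ this
  have hx : ∀ M : N, ∃ x, x ∈ Ioc (0:ℝ) 1 ∧ x ∈ lft M.1 ∧ ∀ y, ¬ s.Good B x y := by
    rintro ⟨M, hM⟩
    obtain ⟨M₀, hM₀, hxM₀⟩ := hN.cover_left hx₀
    obtain ⟨y, hy⟩ := hN.ne _ hM₀
    obtain ⟨g, hg⟩ := s.exists_into (hN.elem M hM) (hN.sub M hM) (hN.ne M hM) (hN.sub _ hM₀ hy)
    have h1 := hN.eq_of_inter hM₀ (hN.pre M hM g) ⟨y, hy, hg⟩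
    refine ⟨s.L g x₀, s.L_mem_Ioc hx₀, ?_, hbadg hbad g⟩
    rw [h1, lft_preimage] at hxM₀
    exact hxM₀
  choose x hxI hxM hxb using hx
  choose a ha hap using fun M : N => hN.aper M.1 M.2
  let F : Set ℝ := ⋃ M : N, s.Dd (a M)
  have : Finite N := hN.fin
  have hF : F.Finite := finite_iUnion fun M => s.Dd_finite _
  have : Finite F := hF
  have hmeet : ∀ z ∈ Ioc (0:ℝ) 1, (∀ y, ¬ s.Good B z y) → ∃ b ∈ B, s.L b z ∈ F := by
    intro z hz hzb
    obtain ⟨M, hM, hzM⟩ := hN.cover_left hz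
    by_contra hc
    push Not at hc
    obtain ⟨y, hy⟩ := hN.exists_good habB hM hzM (ha ⟨M, hM⟩) (hap ⟨M, hM⟩) B.one_mem
      (fun n hn => hc _ (B.pow_mem (ha ⟨M, hM⟩) n) (mem_iUnion.2 ⟨⟨M, hM⟩, by simpa using hn⟩))
      (fun n hn => hc _ (B.pow_mem (B.inv_mem (ha ⟨M, hM⟩)) n)
        (mem_iUnion.2 ⟨⟨M, hM⟩, by simpa using hn⟩))
    exact hzb y hy
  have hpc : ∀ (g h : G) (M : Set ℝ), s.R (g * h) ⁻¹' M = s.R h ⁻¹' (s.R g ⁻¹' M) := by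
    intro g h M; ext z; simp
  have hpi : ∀ (g : G) (M : Set ℝ), s.R g ⁻¹' (s.R g⁻¹ ⁻¹' M) = M := by
    intro g M; rw [← hpc]; simp
  let H : N → Subgroup G := fun M =>
    { carrier := {g | s.R g ⁻¹' M.1 = M.1 ∧ ∃ b ∈ B, s.L g (x M) = s.L b (x M)}
      one_mem' := ⟨by simp, 1, B.one_mem, rfl⟩
      mul_mem' := by
        rintro g h ⟨h1, b, hb, h2⟩ ⟨h3, b', hb', h4⟩
        refine ⟨by rw [hpc, h1, h3], g * b' * g⁻¹ * b, B.mul_mem (hBn.conj_mem _ hb' _) hb, ?_⟩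
        rw [L_mul, h4, L_mul _ _ b, ← h2, ← L_mul, ← L_mul]
        congr 2; group
      inv_mem' := by
        rintro g ⟨h1, b, hb, h2⟩
        refine ⟨?_, g⁻¹ * b⁻¹ * g, ?_, ?_⟩
        · conv_lhs => rw [← h1]
          rw [← hpc]; simp
        · simpa using hBn.conj_mem _ (B.inv_mem hb) g⁻¹
        · rw [L_mul, h2, ← L_mul]; congr 2; group }
  have hHf : ∀ M, (H M).FiniteIndex := by
    intro M
    choose b hb hbF using fun g => hmeet _ (s.L_mem_Ioc (g := g) (hxI M)) (hbadg (hxb M) g)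
    refine finiteIndex_of_map (H M) (α := N × F) (fun g => (⟨_, hN.pre _ M.2 g⁻¹⟩, ⟨_, hbF g⟩)) ?_
    intro g g' h
    have h1 : s.R g⁻¹ ⁻¹' M.1 = s.R g'⁻¹ ⁻¹' M.1 := congrArg (fun z => (z.1 : Set ℝ)) h
    have h2 : s.L (b g) (s.L g (x M)) = s.L (b g') (s.L g' (x M)) := congrArg (fun z => (z.2 : ℝ)) h
    refine ⟨by rw [hpc, h1, hpi], g⁻¹ * ((b g')⁻¹ * b g) * g, ?_, ?_⟩
    · simpa using hBn.conj_mem _ (B.mul_mem (B.inv_mem (hb g')) (hb g)) g⁻¹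
    · have h3 := L_inv_eq h2.symm
      rw [L_mul, ← h3]
      simp only [← L_mul]
      congr 2; group
  refine ⟨⨅ M, H M, Subgroup.finiteIndex_iInf hHf, ?_⟩
  have hagree : ∀ M : N, ∀ h ∈ H M, ∃ b ∈ B, ∀ z ∈ M.1, s.R h z = s.R b z := by
    rintro M h ⟨h1, b, hb, h2⟩
    refine ⟨b, hb, fun z hz => ?_⟩
    have := key hN hBA hab hcyc M.2 (hxM M) (c := b⁻¹ * h) (by rw [L_mul]; exact L_inv_eq h2.symm)
      (by rw [hpc, (hN.inv M.1 M.2).preimage (B.inv_mem hb), h1]) z hz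
    rw [← mem_stabA, stabA_mul] at this
    exact this.symm
  intro g hg h hh
  rw [Subgroup.mem_iInf] at hg hh
  rw [← inv_mul_eq_one]
  apply s.inj
  intro z
  rw [← mem_stabA, stabA_mul]
  by_cases hz : z ∈ Ico (0:ℝ) 1
  · obtain ⟨M, hM, hzM⟩ := hN.cover z hz
    obtain ⟨b, hb, h1⟩ := hagree ⟨M, hM⟩ g (hg _)
    obtain ⟨b', hb', h2⟩ := hagree ⟨M, hM⟩ h (hh _)
    have e1 : s.R (g * h) z = s.R (b * b') z := by
      rw [R_mul, h2 z hzM, h1 _ (((hN.inv M hM) b' hb' z).2 hzM), R_mul]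
    have e2 : s.R (h * g) z = s.R (b' * b) z := by
      rw [R_mul, h1 z hzM, h2 _ (((hN.inv M hM) b hb z).2 hzM), R_mul]
    rw [e1, e2, habB _ hb _ hb']
  · rw [s.out _ _ hz, s.out _ _ hz]

end Atoms

theorem main_abelian (s : Sys G) {A : Subgroup G} [hA : A.Normal]
    (hab : ∀ x ∈ A, ∀ y ∈ A, x * y = y * x) (ha : ∃ a ∈ A, ¬ IsOfFinOrder a) :
    ∃ H : Subgroup G, H.FiniteIndex ∧ ∀ x ∈ H, ∀ y ∈ H, x * y = y * x := by
  obtain ⟨N, hN⟩ := s.exists_atoms hab ha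
  by_cases hgood : ∀ x ∈ Ioc (0:ℝ) 1, ∃ y, s.Good A x y
  · obtain ⟨ψ, h1, h2, h3, h4⟩ := hN.exists_psi hgood
    exact abelian_of_psi s h1 h2 h3 h4
  push Not at hgood
  obtain ⟨x, hx, hbad⟩ := hgood
  obtain ⟨m, hm, M, hM, a, haA, hcyc⟩ := hN.bad_step hab hx hbad
  let B : Subgroup G :=
    { carrier := {g | ∃ b ∈ A, b ^ m = g}
      one_mem' := ⟨1, A.one_mem, one_pow _⟩
      mul_mem' := by
        rintro _ _ ⟨b, hb, rfl⟩ ⟨c, hc, rfl⟩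
        exact ⟨b * c, A.mul_mem hb hc, (show Commute b c from hab _ hb _ hc).mul_pow m⟩
      inv_mem' := by
        rintro _ ⟨b, hb, rfl⟩
        exact ⟨b⁻¹, A.inv_mem hb, inv_pow _ _⟩ }
  have hBA : B ≤ A := by
    rintro _ ⟨b, hb, rfl⟩
    exact A.pow_mem hb m
  have hBn : B.Normal := ⟨by
    rintro _ ⟨b, hb, rfl⟩ g
    exact ⟨g * b * g⁻¹, hA.conj_mem b hb g, conj_pow⟩⟩
  have habB : ∀ x ∈ B, ∀ y ∈ B, x * y = y * x := fun x hx y hy => hab x (hBA hx) y (hBA hy)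
  have haB : ∃ a ∈ B, ¬ IsOfFinOrder a := by
    obtain ⟨a₀, h1, h2⟩ := ha
    exact ⟨a₀ ^ m, ⟨a₀, h1, rfl⟩, fun h => h2 (h.of_pow hm.ne')⟩
  have hcycB : ∀ x ∈ Ico (0:ℝ) 1, ∃ a ∈ A, ∀ d ∈ B, ∃ i : ℤ, s.R d x = s.R (a ^ i) x := by
    intro x hx
    obtain ⟨g, hg⟩ := s.exists_into (hN.elem M hM) (hN.sub M hM) (hN.ne M hM) hx
    refine ⟨g⁻¹ * a * g, by simpa using hA.conj_mem a haA g⁻¹, ?_⟩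
    rintro _ ⟨b, hb, rfl⟩
    obtain ⟨i, hi⟩ := hcyc (g * b * g⁻¹) (hA.conj_mem b hb g)
    refine ⟨i, ?_⟩
    have h1 := hi _ hg
    have h2 : (g⁻¹ * a * g) ^ i = g⁻¹ * a ^ i * g := by
      have := conj_zpow (i := i) (a := g⁻¹) (b := a)
      rwa [inv_inv] at this
    rw [h2, R_mul, R_mul, ← h1, conj_pow, ← R_mul, ← R_mul]
    congr 2; group
  obtain ⟨N', hN'⟩ := s.exists_atoms habB haB
  by_cases hgood : ∀ x ∈ Ioc (0:ℝ) 1, ∃ y, s.Good B x y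
  · obtain ⟨ψ, h1, h2, h3, h4⟩ := hN'.exists_psi hgood
    exact abelian_of_psi s h1 h2 h3 h4
  push Not at hgood
  obtain ⟨x, hx, hbad⟩ := hgood
  exact Atoms.bad_abelian hN' hBA hab hcycB hx hbad
end Sys
end Ietx


namespace Ietx

theorem fg_of_finiteIndex {K : Type*} [Group K] (H : Subgroup K) [H.FiniteIndex] (hH : H.FG) :
    Group.FG K := by
  obtain ⟨S, hS⟩ := hH
  have : Finite (K ⧸ H) := inferInstance
  have hT : (range (fun q : K ⧸ H => q.out)).Finite := finite_range _
  rw [Group.fg_iff]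
  refine ⟨(S : Set K) ∪ range (fun q : K ⧸ H => q.out), ?_, S.finite_toSet.union hT⟩
  rw [eq_top_iff]
  intro g _
  have h1 : (g : K ⧸ H).out⁻¹ * g ∈ H := by
    rw [← QuotientGroup.eq]; simp
  have h2 := (hS.ge.trans
    (Subgroup.closure_mono (subset_union_left (t := range (fun q : K ⧸ H => q.out))))) h1
  have h3 : (g : K ⧸ H).out ∈ Subgroup.closure ((S : Set K) ∪ range (fun q : K ⧸ H => q.out)) :=
    Subgroup.subset_closure (Or.inr ⟨_, rfl⟩)
  have := Subgroup.mul_mem _ h3 h2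
  rwa [mul_inv_cancel_left] at this

theorem fg_sub {K : Type*} [Group K] [Group.FG K] (H A : Subgroup K) [H.FiniteIndex]
    (hab : ∀ x ∈ H, ∀ y ∈ H, x * y = y * x) : Group.FG A := by
  let _ : CommGroup H := { (inferInstance : Group H) with
      mul_comm := fun p q => Subtype.ext (hab _ p.2 _ q.2) }
  have hHfg : Group.FG H := inferInstance
  have h1 : (A.subgroupOf H).FG := by
    rw [Subgroup.fg_iff_add_fg]
    have : Module.Finite ℤ (Additive H) := Module.Finite.iff_addGroup_fg.2 inferInstance
    have := IsNoetherian.noetherian (AddSubgroup.toIntSubmodule (A.subgroupOf H).toAddSubgroup)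
    rw [Submodule.fg_iff_addSubgroup_fg] at this
    exact this
  have h2 := (Group.fg_iff_subgroup_fg _).2 h1
  let f : A.subgroupOf H →* H.subgroupOf A :=
    { toFun := fun x => ⟨⟨x.1.1, x.2⟩, x.1.2⟩
      map_one' := rfl
      map_mul' := fun _ _ => rfl }
  have hf : Function.Surjective f := fun x => ⟨⟨⟨x.1.1, x.2⟩, x.1.2⟩, rfl⟩
  have h3 : (H.subgroupOf A).FG := (Group.fg_iff_subgroup_fg _).1 (Group.fg_of_surjective hf)
  exact fg_of_finiteIndex (H.subgroupOf A) h3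
end Ietx


namespace Ietx

open Classical in
/-- extension by the identity -/
noncomputable def ext : Equiv.Perm I01 →* Equiv.Perm ℝ := Equiv.Perm.ofSubtype

theorem ext_out (T : Equiv.Perm I01) {x : ℝ} (hx : x ∉ Ico (0:ℝ) 1) : ext T x = x :=
  Equiv.Perm.ofSubtype_apply_of_not_mem _ hx

theorem ext_mem (T : Equiv.Perm I01) {x : ℝ} (hx : x ∈ Ico (0:ℝ) 1) : ext T x = T ⟨x, hx⟩ :=
  Equiv.Perm.ofSubtype_apply_of_mem _ hx

theorem ext_inj {T : Equiv.Perm I01} (h : ∀ x, ext T x = x) : T = 1 := by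
  ext x
  have := h x.1
  rw [ext_mem T x.2] at this
  exact this

theorem locate_Ico {n : ℕ} (a : Fin (n + 1) → ℝ) {x : ℝ} (h0 : a 0 ≤ x) (k : Fin (n + 1)) :
    x < a k → ∃ i : Fin n, x ∈ Ico (a i.castSucc) (a i.succ) := by
  induction k using Fin.induction with
  | zero => intro h; exact absurd h0 (not_le.2 h)
  | succ i ih =>
    intro h
    by_cases h1 : x < a i.castSucc
    · exact ih h1
    · exact ⟨i, not_lt.1 h1, h⟩

theorem locate_Ioc {n : ℕ} (a : Fin (n + 1) → ℝ) {x : ℝ} (h0 : a 0 < x) (k : Fin (n + 1)) :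
    x ≤ a k → ∃ i : Fin n, x ∈ Ioc (a i.castSucc) (a i.succ) := by
  induction k using Fin.induction with
  | zero => intro h; exact absurd h0 (not_lt.2 h)
  | succ i ih =>
    intro h
    by_cases h1 : x ≤ a i.castSucc
    · exact ih h1
    · exact ⟨i, not_le.1 h1, h⟩

theorem ext_piece {T : Equiv.Perm I01} (hT : IsIET T) :
    ∃ (n : ℕ) (a : Fin (n + 1) → ℝ) (c : Fin n → ℝ), a 0 = 0 ∧ a (Fin.last n) = 1 ∧
      (∀ i : Fin n, Ico (a i.castSucc) (a i.succ) ⊆ Ico 0 1) ∧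
      ∀ i : Fin n, ∀ x ∈ Ico (a i.castSucc) (a i.succ), ext T x = x + c i := by
  obtain ⟨n, a, hm, h0, h1, h⟩ := hT
  choose c hc using h
  have hsub : ∀ i : Fin n, Ico (a i.castSucc) (a i.succ) ⊆ Ico 0 1 := by
    intro i
    apply Ico_subset_Ico
    · rw [← h0]; exact hm.monotone (Fin.zero_le _)
    · rw [← h1]; exact hm.monotone (Fin.le_last _)
  refine ⟨n, a, c, h0, h1, hsub, ?_⟩
  intro i x hx
  rw [ext_mem T (hsub i hx)]
  exact hc i ⟨x, hsub i hx⟩ hx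

theorem ext_right {T : Equiv.Perm I01} (hT : IsIET T) (x : ℝ) :
    ∀ᶠ y in 𝓝[>] x, ext T y = y + (ext T x - x) := by
  obtain ⟨n, a, c, h0, h1, hsub, hc⟩ := ext_piece hT
  rcases lt_or_ge x 0 with hx | hx
  · filter_upwards [Ioo_mem_nhdsGT hx] with y hy
    rw [ext_out T (fun h => absurd h.1 (not_le.2 hx)), ext_out T (fun h => absurd h.1 (not_le.2 hy.2))]
    ring
  rcases le_or_gt 1 x with hx1 | hx1
  · filter_upwards [self_mem_nhdsWithin] with y hy
    have hy : x < y := hy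
    rw [ext_out T (fun h => absurd h.2 (not_lt.2 hx1)),
      ext_out T (fun h => absurd h.2 (not_lt.2 (hx1.trans hy.le)))]
    ring
  obtain ⟨i, hi⟩ := locate_Ico a (x := x) (by rwa [h0]) (Fin.last n) (by rwa [h1])
  filter_upwards [Ioo_mem_nhdsGT hi.2] with y hy
  rw [hc i x hi, hc i y ⟨hi.1.trans hy.1.le, hy.2⟩]
  ring

theorem ext_left {T : Equiv.Perm I01} (hT : IsIET T) (x : ℝ) :
    ∃ c, ∀ᶠ y in 𝓝[<] x, ext T y = y + c := by
  obtain ⟨n, a, c, h0, h1, hsub, hc⟩ := ext_piece hT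
  rcases le_or_gt x 0 with hx | hx
  · refine ⟨0, ?_⟩
    filter_upwards [self_mem_nhdsWithin] with y hy
    have hy : y < x := hy
    rw [ext_out T (fun h => absurd h.1 (not_le.2 (hy.trans_le hx)))]
    ring
  rcases lt_or_ge 1 x with hx1 | hx1
  · refine ⟨0, ?_⟩
    filter_upwards [Ioo_mem_nhdsLT hx1] with y hy
    rw [ext_out T (fun h => absurd h.2 (not_lt.2 hy.1.le))]
    ring
  obtain ⟨i, hi⟩ := locate_Ioc a (x := x) (by rwa [h0]) (Fin.last n) (by rwa [h1])
  refine ⟨c i, ?_⟩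
  filter_upwards [Ioo_mem_nhdsLT hi.1] with y hy
  rw [hc i y ⟨hy.1.le, hy.2.trans_le hi.2⟩]

theorem ext_meas {T : Equiv.Perm I01} (hT : IsIET T) :
    Measurable (ext T) ∧ ∃ C : Set ℝ, C.Finite ∧ ∀ x, ext T x - x ∈ C := by
  obtain ⟨n, a, c, h0, h1, hsub, hc⟩ := ext_piece hT
  constructor
  · intro S hS
    have : ext T ⁻¹' S = ((Ico 0 1)ᶜ ∩ S) ∪
        ⋃ i : Fin n, (Ico (a i.castSucc) (a i.succ) ∩ (fun x => x + c i) ⁻¹' S) := by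
      ext x
      constructor
      · intro hx
        by_cases h : x ∈ Ico (0:ℝ) 1
        · right
          obtain ⟨i, hi⟩ := locate_Ico a (x := x) (by rw [h0]; exact h.1) (Fin.last n) (by rw [h1]; exact h.2)
          refine mem_iUnion.2 ⟨i, hi, ?_⟩
          rw [mem_preimage, hc i x hi] at hx
          exact hx
        · left
          rw [mem_preimage, ext_out T h] at hx
          exact ⟨h, hx⟩
      · rintro (⟨h, hx⟩ | hx)
        · rw [mem_preimage, ext_out T h]; exact hx
        · obtain ⟨i, hi, hx⟩ := mem_iUnion.1 hx
          rw [mem_preimage, hc i x hi]; exact hx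
    rw [this]
    refine (measurableSet_Ico.compl.inter hS).union (MeasurableSet.iUnion fun i => ?_)
    exact measurableSet_Ico.inter ((measurable_id.add_const (c i)) hS)
  · refine ⟨insert 0 (range c), (finite_range c).insert 0, fun x => ?_⟩
    by_cases h : x ∈ Ico (0:ℝ) 1
    · obtain ⟨i, hi⟩ := locate_Ico a (x := x) (by rw [h0]; exact h.1) (Fin.last n) (by rw [h1]; exact h.2)
      right
      exact ⟨i, by rw [hc i x hi]; ring⟩
    · left
      rw [ext_out T h]; ring

theorem volume_image_le {f : ℝ → ℝ} (hf : Measurable f) {C : Set ℝ} (hC : C.Finite)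
    (h : ∀ x, f x - x ∈ C) {S : Set ℝ} (hS : MeasurableSet S) : volume (f '' S) ≤ volume S := by
  have : Countable C := hC.countable
  let J : C → Set ℝ := fun c => S ∩ {x | f x - x = c}
  have hJ : ∀ c, MeasurableSet (J c) := fun c =>
    hS.inter (measurableSet_eq_fun (hf.sub measurable_id) measurable_const)
  have hdis : Pairwise (Function.onFun Disjoint J) := by
    intro c d hcd
    rw [Function.onFun, Set.disjoint_left]
    rintro x ⟨_, h1⟩ ⟨_, h2⟩
    exact hcd (Subtype.ext (h1.symm.trans h2))
  have hU : ⋃ c, J c = S := by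
    ext x
    simp only [mem_iUnion]
    exact ⟨fun ⟨c, hc⟩ => hc.1, fun hx => ⟨⟨_, h x⟩, hx, rfl⟩⟩
  calc volume (f '' S) = volume (⋃ c, f '' J c) := by rw [← image_iUnion, hU]
    _ ≤ ∑' c, volume (f '' J c) := measure_iUnion_le _
    _ = ∑' c, volume (J c) := by
      congr 1; ext c
      have : f '' J c = (fun x => x + (c:ℝ)) '' J c := by
        apply image_congr
        rintro x ⟨_, hx⟩
        have hx : f x - x = c := hx
        linarith
      rw [this, image_add_right, measure_preimage_add_right]
    _ = volume S := by rw [← measure_iUnion hdis hJ, hU]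

theorem ext_mp {T : Equiv.Perm I01} (hT : IsIET T) (hT' : IsIET T⁻¹) :
    MeasurePreserving (ext T) volume volume := by
  obtain ⟨h1, C, hC, h2⟩ := ext_meas hT
  obtain ⟨h1', C', hC', h2'⟩ := ext_meas hT'
  refine ⟨h1, Measure.ext fun S hS => ?_⟩
  rw [Measure.map_apply h1 hS]
  apply le_antisymm
  · have := volume_image_le h1' hC' h2' hS
    have h3 : ext T⁻¹ '' S = ext T ⁻¹' S := by
      rw [map_inv]; exact (ext T).symm.image_eq_preimage_symm S
    rwa [h3] at this
  · have := volume_image_le h1 hC h2 (h1 hS)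
    rwa [image_preimage_eq _ (ext T).surjective] at this

theorem exists_sys (G : Subgroup (Equiv.Perm I01)) (hGiet : ∀ g ∈ G, IsIET g)
    (hirr : ∀ x : I01, Dense {y : I01 | ∃ g ∈ G, g x = y}) : Nonempty (Sys G) := by
  choose l hl using fun (g : G) => ext_left (hGiet g.1 g.2)
  have huniq : ∀ (g : G) x c, (∀ᶠ y in 𝓝[<] x, ext g.1 y = y + c) → l g x = c := by
    intro g x c h
    obtain ⟨y, h1, h2⟩ := (h.and (hl g x)).exists
    linarith
  let F : G →* Function.End ℝ :=
    { toFun := fun g x => x + l g x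
      map_one' := by
        funext x
        have : l 1 x = 0 := huniq 1 x 0 (Eventually.of_forall fun y => by simp)
        show x + l 1 x = x
        rw [this, add_zero]
      map_mul' := by
        intro g h
        funext x
        show x + l (g * h) x = (x + l h x) + l g (x + l h x)
        rw [huniq (g * h) x (l h x + l g (x + l h x)) ?_]
        · ring
        have ht : Tendsto (fun y => y + l h x) (𝓝[<] x) (𝓝[<] (x + l h x)) := by
          apply tendsto_nhdsWithin_of_tendsto_nhds_of_eventually_within
          · have : Tendsto (fun y => y + l h x) (𝓝 x) (𝓝 (x + l h x)) :=
              (continuous_id.add continuous_const).tendsto x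
            exact this.mono_left nhdsWithin_le_nhds
          · filter_upwards [self_mem_nhdsWithin] with y hy
            have hy : y < x := hy
            exact mem_Iio.2 (by linarith)
        filter_upwards [hl h x, ht.eventually (hl g (x + l h x))] with y h1 h2
        rw [Subgroup.coe_mul, map_mul, Equiv.Perm.mul_apply, h1, h2]
        ring }
  have hF : ∀ g x, F.toHomPerm g x = x + l g x := fun g x => rfl
  refine ⟨{ R := ext.comp G.subtype, L := F.toHomPerm, hR := ?_, hL := ?_, out := ?_, inj := ?_,
            dens := ?_, mp := ?_ }⟩
  · intro g x; exact ext_right (hGiet g.1 g.2) x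
  · intro g x
    filter_upwards [hl g x] with y hy
    rw [hF, add_sub_cancel_left]
    exact hy
  · intro g x hx; exact ext_out _ hx
  · intro g h; exact Subtype.ext (ext_inj h)
  · intro x hx u v hu huv hv
    have hmid : (u + v) / 2 ∈ Ico (0:ℝ) 1 := ⟨by linarith, by linarith⟩
    obtain ⟨y, hy1, g, hg, hy2⟩ := (hirr ⟨x, hx⟩).inter_open_nonempty
      ((↑) ⁻¹' (Ioo u v) : Set I01) (isOpen_Ioo.preimage continuous_subtype_val)
      ⟨⟨_, hmid⟩, by show _ < _; simp only; linarith, by show _ < _; simp only; linarith⟩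
    refine ⟨⟨g, hg⟩, ?_⟩
    show ext g x ∈ _
    rw [ext_mem g hx, hy2]
    exact hy1
  · intro g
    exact ext_mp (hGiet g.1 g.2) (hGiet _ (G.inv_mem g.2))

end Ietx

end

/-- If `G < IET` is irreducible (all orbits dense) and has an abelian normal subgroup `A`
containing an element of infinite order, then `G` is virtually abelian; in particular if `G`
is finitely generated then so is `A`. -/
theorem virtually_abelian_of_irreducible_with_infinite_order_normal_abelian
    (G A : Subgroup (Equiv.Perm I01)) (hGiet : ∀ g ∈ G, IsIET g)
    (hirr : ∀ x : I01, Dense {y : I01 | ∃ g ∈ G, g x = y})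
    (hAG : A ≤ G)
    (hnorm : ∀ g ∈ G, ∀ a ∈ A, g * a * g⁻¹ ∈ A)
    (hab : ∀ x ∈ A, ∀ y ∈ A, x * y = y * x)
    (ha : ∃ a ∈ A, ¬ IsOfFinOrder a) :
    (∃ H : Subgroup ↥G, H.FiniteIndex ∧ ∀ x y : ↥H, x * y = y * x) ∧
    (Group.FG ↥G → Group.FG ↥A) := by
  obtain ⟨s⟩ := Ietx.exists_sys G hGiet hirr
  have hn : (A.subgroupOf G).Normal := ⟨fun a haA g => hnorm g.1 g.2 a.1 haA⟩
  obtain ⟨H, hH, hcomm⟩ := s.main_abelian (A := A.subgroupOf G)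
    (fun x hx y hy => Subtype.ext (hab _ hx _ hy)) (by
      obtain ⟨a, h1, h2⟩ := ha
      refine ⟨⟨a, hAG h1⟩, h1, fun h => h2 ?_⟩
      exact G.subtype.isOfFinOrder h)
  refine ⟨⟨H, hH, fun x y => Subtype.ext (hcomm _ x.2 _ y.2)⟩, fun hfg => ?_⟩
  have h1 := Ietx.fg_sub H (A.subgroupOf G) hcomm
  exact Group.fg_of_surjective (f := (Subgroup.subgroupOfEquivOfLe hAG).toMonoidHom)
    (Subgroup.subgroupOfEquivOfLe hAG).surjective
end

section
/- Let F₁,…,F_n be groups, let F = F₁ × ⋯ × F_n act on a set X, and let x ∈ X. Identifying each F_i with its canonical copy inside F, set S_i = Stab_F(x) ∩ F_i. Assume Stab_F(x) is a normal subgroup of F. Then each S_i is normal in F_i, and, writing Z(F_i/S_i) for the center of F_i/S_i and Q_i = (F_i/S_i)/Z(F_i/S_i), the natural surjective homomorphism F₁ × ⋯ × F_n → Q₁ × ⋯ × Q_n factors through a surjective homomorphism F/Stab_F(x) → Q₁ × ⋯ × Q_n. In particular, if every quotient F_i/S_i is non-abelian, then the orbit F·x has cardinality at least 2^n. -/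
theorem key_central {n : ℕ} (F : Fin n → Type*) [∀ i, Group (F i)]
    (N : Subgroup (∀ i, F i)) (hN : N.Normal)
    (i : Fin n) [hi : (Subgroup.comap (MonoidHom.mulSingle F i) N).Normal]
    (g : ∀ i, F i) (hg : g ∈ N) :
    (QuotientGroup.mk (g i) : F i ⧸ Subgroup.comap (MonoidHom.mulSingle F i) N) ∈
      Subgroup.center (F i ⧸ Subgroup.comap (MonoidHom.mulSingle F i) N) := by
  rw [Subgroup.mem_center_iff]
  intro q
  obtain ⟨h, rfl⟩ := QuotientGroup.mk_surjective q
  rw [← QuotientGroup.mk_mul, ← QuotientGroup.mk_mul, QuotientGroup.eq, Subgroup.mem_comap]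
  -- the commutator of `g` with an element of `F i` lies in `N` and is supported at `i`
  have h1 : g⁻¹ * ((Pi.mulSingle i h⁻¹ : ∀ i, F i) * g * (Pi.mulSingle i h⁻¹)⁻¹) ∈ N :=
    N.mul_mem (N.inv_mem hg) (hN.conj_mem g hg _)
  convert h1 using 1
  funext j
  by_cases hj : j = i
  · subst hj
    simp [mul_assoc]
  · simp [hj]

/-- Let `F = F 0 × ⋯ × F (n-1)` act on a set `X`, let `x ∈ X`, and assume the stabilizer of
`x` is normal in `F`. With `S i = Stab_F(x) ∩ F i` (via `MonoidHom.mulSingle`), each `S i` is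
normal in `F i`, and, writing `Q i = (F i ⧸ S i) ⧸ Z(F i ⧸ S i)`, the natural surjection
`F → Π i, Q i` factors through a surjection `F ⧸ Stab_F(x) → Π i, Q i`. In particular, if
every `F i ⧸ S i` is non-abelian, the orbit of `x` has cardinality at least `2 ^ n`. -/
theorem factorization_through_quotient_by_stabilizer
    {n : ℕ} (F : Fin n → Type*) [∀ i, Group (F i)]
    (X : Type*) [MulAction (∀ i, F i) X] (x : X)
    (hN : (MulAction.stabilizer (∀ i, F i) x).Normal) :
    (∀ i, (Subgroup.comap (MonoidHom.mulSingle F i)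
        (MulAction.stabilizer (∀ i, F i) x)).Normal) ∧
    (letI := hN
     letI : ∀ i, (Subgroup.comap (MonoidHom.mulSingle F i)
         (MulAction.stabilizer (∀ i, F i) x)).Normal :=
       fun i => hN.comap (MonoidHom.mulSingle F i)
     (∃ ψ : ((∀ i, F i) ⧸ MulAction.stabilizer (∀ i, F i) x) →*
         (∀ i, (F i ⧸ Subgroup.comap (MonoidHom.mulSingle F i)
             (MulAction.stabilizer (∀ i, F i) x)) ⧸
           Subgroup.center (F i ⧸ Subgroup.comap (MonoidHom.mulSingle F i)
             (MulAction.stabilizer (∀ i, F i) x))),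
       Function.Surjective ψ ∧
       ψ.comp (QuotientGroup.mk' (MulAction.stabilizer (∀ i, F i) x)) =
         Pi.monoidHom (fun i =>
           ((QuotientGroup.mk' (Subgroup.center
               (F i ⧸ Subgroup.comap (MonoidHom.mulSingle F i)
                 (MulAction.stabilizer (∀ i, F i) x)))).comp
             (QuotientGroup.mk' (Subgroup.comap (MonoidHom.mulSingle F i)
               (MulAction.stabilizer (∀ i, F i) x)))).comp
           (Pi.evalMonoidHom F i))) ∧
     ((∀ i, ∃ a b : F i ⧸ Subgroup.comap (MonoidHom.mulSingle F i)
           (MulAction.stabilizer (∀ i, F i) x), a * b ≠ b * a) →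
       (2 : Cardinal) ^ n ≤ Cardinal.mk ↥(MulAction.orbit (∀ i, F i) x))) := by
  have hS : ∀ i, (Subgroup.comap (MonoidHom.mulSingle F i)
      (MulAction.stabilizer (∀ i, F i) x)).Normal :=
    fun i => hN.comap (MonoidHom.mulSingle F i)
  refine ⟨hS, ⟨QuotientGroup.lift _ (Pi.monoidHom (fun i =>
           ((QuotientGroup.mk' (Subgroup.center
               (F i ⧸ Subgroup.comap (MonoidHom.mulSingle F i)
                 (MulAction.stabilizer (∀ i, F i) x)))).comp
             (QuotientGroup.mk' (Subgroup.comap (MonoidHom.mulSingle F i)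
               (MulAction.stabilizer (∀ i, F i) x)))).comp
           (Pi.evalMonoidHom F i))) ?_, ?_, ?_⟩, ?_⟩
  · intro g hg
    funext i
    exact (QuotientGroup.eq_one_iff _).2 (key_central F _ hN i g hg)
  · intro q
    have h : ∀ i, ∃ a : F i, QuotientGroup.mk' (Subgroup.center
               (F i ⧸ Subgroup.comap (MonoidHom.mulSingle F i)
                 (MulAction.stabilizer (∀ i, F i) x))) (QuotientGroup.mk a) = q i := by
      intro i
      obtain ⟨b, hb⟩ := QuotientGroup.mk'_surjective _ (q i)
      obtain ⟨a, rfl⟩ := QuotientGroup.mk_surjective b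
      exact ⟨a, hb⟩
    choose a ha using h
    exact ⟨QuotientGroup.mk a, funext ha⟩
  · rfl
  · intro hab
    have h : ∀ i, ∃ c : F i,
        (QuotientGroup.mk c : F i ⧸ Subgroup.comap (MonoidHom.mulSingle F i)
          (MulAction.stabilizer (∀ i, F i) x)) ∉ Subgroup.center
            (F i ⧸ Subgroup.comap (MonoidHom.mulSingle F i)
              (MulAction.stabilizer (∀ i, F i) x)) := by
      intro i
      obtain ⟨a, b, hne⟩ := hab i
      obtain ⟨c, rfl⟩ := QuotientGroup.mk_surjective a
      exact ⟨c, fun hc => hne (Subgroup.mem_center_iff.1 hc b).symm⟩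
    choose c hc using h
    let e : (Fin n → Bool) → ∀ i, F i := fun s i => if s i then c i else 1
    have he : ∀ s t : Fin n → Bool, e s • x = e t • x → ∀ i, t i = true → s i = true := by
      intro s t hst i hti
      by_contra hsi
      have hmem : (e s)⁻¹ * e t ∈ MulAction.stabilizer (∀ i, F i) x := by
        rw [MulAction.mem_stabilizer_iff, mul_smul, ← hst, inv_smul_smul]
      have := key_central F _ hN i _ hmem
      apply hc i
      simpa [e, hti, hsi] using this
    have hinj : Function.Injective (fun s : ULift (Fin n → Bool) =>
        (⟨e s.down • x, MulAction.mem_orbit x _⟩ : MulAction.orbit (∀ i, F i) x)) := by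
      intro s t hst
      have h' : e s.down • x = e t.down • x := congrArg Subtype.val hst
      apply ULift.ext
      funext i
      exact Bool.eq_iff_iff.2 ⟨he _ _ h'.symm i, he _ _ h' i⟩
    have := Cardinal.mk_le_of_injective hinj
    simpa using this
end

section
/- Let G be a subgroup of IET, let A be a finite abelian group, and let J be a subdomain of [0,1). Let G act on the additive group A^{[0,1)} of all functions [0,1) → A by (g·f)(x) = f(g⁻¹(x)), and let F_J be the smallest G-invariant subgroup of A^{[0,1)} containing, for every a ∈ A, the function a·1_J that equals a on J and 0 elsewhere. Then the semidirect product F_J ⋊ G (with G acting on F_J as above) embeds in IET. -/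
/-- A subdomain of `[0,1)`: a nonempty finite union of half-open intervals `[a,b)`
with `0 ≤ a < b ≤ 1`. -/
def IsSubdomain (J : Set I01) : Prop :=
  J.Nonempty ∧ ∃ F : Finset (ℝ × ℝ),
    (∀ p ∈ F, 0 ≤ p.1 ∧ p.1 < p.2 ∧ p.2 ≤ 1) ∧
    ∀ x : I01, x ∈ J ↔ ∃ p ∈ F, (x : ℝ) ∈ Set.Ico p.1 p.2

/-- A subset `J` of `[0,1)` is invariant under a bijection `g` of `[0,1)`. -/
def InvariantUnder (g : Equiv.Perm I01) (J : Set I01) : Prop :=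
  ∀ x, g x ∈ J ↔ x ∈ J

section LL

variable {X : Type*} (A : Type*) [AddCommGroup A] (G : Subgroup (Equiv.Perm X))
  (gens : Set (X → A))

/-- The shift action of a permutation `g` of `X` on functions `X → A`:
`(g · f)(x) = f (g⁻¹ x)`. -/
def shiftF (g : Equiv.Perm X) (f : X → A) : X → A := fun x => f (g.symm x)

/-- The smallest `G`-invariant additive subgroup of `X → A` containing `gens`. -/
def genInvSubgroup : AddSubgroup (X → A) :=
  sInf {K : AddSubgroup (X → A) | gens ⊆ ↑K ∧ ∀ g ∈ G, ∀ f ∈ K, shiftF A g f ∈ K}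

lemma shift_mem_genInvSubgroup {g : Equiv.Perm X} (hg : g ∈ G) {f : X → A}
    (hf : f ∈ genInvSubgroup A G gens) : shiftF A g f ∈ genInvSubgroup A G gens := by
  rw [genInvSubgroup, AddSubgroup.mem_sInf] at hf ⊢
  intro K hK
  exact hK.2 g hg f (hf K hK)

/-- The action of `G` on the subgroup `genInvSubgroup A G gens`, as a homomorphism to the
multiplicative automorphisms of the corresponding multiplicative group. -/
def llShift : ↥G →* MulAut (Multiplicative ↥(genInvSubgroup A G gens)) where
  toFun g := AddEquiv.toMultiplicative
    { toFun := fun f => ⟨shiftF A (g : Equiv.Perm X) f.1,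
        shift_mem_genInvSubgroup A G gens g.2 f.2⟩
      invFun := fun f => ⟨shiftF A ((g⁻¹ : ↥G) : Equiv.Perm X) f.1,
        shift_mem_genInvSubgroup A G gens (g⁻¹ : ↥G).2 f.2⟩
      left_inv := fun f => by
        apply Subtype.ext
        funext x
        simp [shiftF, Equiv.Perm.inv_def]
      right_inv := fun f => by
        apply Subtype.ext
        funext x
        simp [shiftF, Equiv.Perm.inv_def]
      map_add' := fun f₁ f₂ => rfl }
  map_one' := by
    ext f
    rfl
  map_mul' := fun g h => by
    ext f
    rfl

/-- The lamplighter-like group `F_J ⋊ G`. -/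
abbrev LLGroup := (Multiplicative ↥(genInvSubgroup A G gens)) ⋊[llShift A G gens] ↥G

end LL

/-- Piecewise constant (right-continuous) functions on `[0,1)`. -/
def PC {β : Type*} (f : I01 → β) : Prop :=
  ∃ S : Set ℝ, S.Finite ∧ ∀ x y : I01, (x : ℝ) ≤ y →
    (∀ s ∈ S, ¬ ((x : ℝ) < s ∧ s ≤ y)) → f x = f y

lemma PC.map₂ {β γ δ : Type*} {f : I01 → β} {g : I01 → γ} (hf : PC f) (hg : PC g)
    (m : β → γ → δ) : PC (fun x => m (f x) (g x)) := by
  obtain ⟨S, hS, h⟩ := hf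
  obtain ⟨S', hS', h'⟩ := hg
  refine ⟨S ∪ S', hS.union hS', fun x y hxy hs => ?_⟩
  simp only
  rw [h x y hxy fun s hs1 => hs s (Or.inl hs1), h' x y hxy fun s hs1 => hs s (Or.inr hs1)]

lemma PC.const {β : Type*} (b : β) : PC (fun _ => b) :=
  ⟨∅, Set.finite_empty, fun _ _ _ _ => rfl⟩

lemma isIET_of_PC (T : Equiv.Perm I01) (h : PC fun x => (T x : ℝ) - x) : IsIET T := by
  classical
  obtain ⟨S, hS, h⟩ := h
  let F : Finset ℝ := insert 0 (insert 1 (hS.toFinset.filter fun s => 0 < s ∧ s < 1))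
  have h0 : (0 : ℝ) ∈ F := by simp [F]
  have h1 : (1 : ℝ) ∈ F := by simp [F]
  have hF : ∀ s ∈ F, 0 ≤ s ∧ s ≤ 1 := by
    intro s hs
    simp only [F, Finset.mem_insert, Finset.mem_filter] at hs
    rcases hs with rfl | rfl | hs
    · norm_num
    · norm_num
    · exact ⟨hs.2.1.le, hs.2.2.le⟩
  have hc : F.card = (F.card - 1) + 1 := by
    have := Finset.card_pos.mpr ⟨_, h0⟩
    omega
  let a := F.orderEmbOfFin hc
  have hr : ∀ s ∈ F, ∃ i, a i = s := by
    intro s hs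
    have := F.range_orderEmbOfFin hc
    have hs' : s ∈ Set.range (F.orderEmbOfFin hc) := by rw [this]; exact hs
    exact hs'
  have ha : ∀ i, a i ∈ F := fun i => F.orderEmbOfFin_mem hc i
  refine ⟨F.card - 1, a, a.strictMono, ?_, ?_, ?_⟩
  · obtain ⟨i, hi⟩ := hr 0 h0
    apply le_antisymm _ (hF _ (ha _)).1
    rw [← hi]
    exact a.monotone (Fin.zero_le i)
  · obtain ⟨i, hi⟩ := hr 1 h1
    apply le_antisymm (hF _ (ha _)).2
    rw [← hi]
    exact a.monotone (Fin.le_last i)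
  · intro i
    have hlt : a i.castSucc < a i.succ := a.strictMono i.castSucc_lt_succ
    have hle := (hF _ (ha i.succ)).2
    have hge := (hF _ (ha i.castSucc)).1
    let p : I01 := ⟨a i.castSucc, hge, hlt.trans_le hle⟩
    refine ⟨(T p : ℝ) - p, fun x hx => ?_⟩
    have := h p x hx.1 (fun s hs hsx => ?_)
    · linarith
    · have hs1 : s < a i.succ := hsx.2.trans_lt hx.2
      have hs0 : a i.castSucc < s := hsx.1
      have hsF : s ∈ F := by
        simp only [F, Finset.mem_insert, Finset.mem_filter]
        exact Or.inr (Or.inr ⟨by simpa using hs, by linarith, by linarith⟩)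
      obtain ⟨j, rfl⟩ := hr s hsF
      rw [a.lt_iff_lt] at hs1 hs0
      rw [Fin.lt_def] at hs1 hs0
      simp at hs1 hs0
      omega

lemma PC_of_isIET (T : Equiv.Perm I01) (h : IsIET T) : PC fun x => (T x : ℝ) - x := by
  classical
  obtain ⟨n, a, ha, h0, h1, h⟩ := h
  refine ⟨Set.range a, Set.finite_range a, fun x y hxy hs => ?_⟩
  have hne : (Finset.univ.filter fun i => a i ≤ (x : ℝ)).Nonempty :=
    ⟨0, by simp [h0, x.2.1]⟩
  obtain ⟨i, hi, hmax⟩ := Finset.exists_max_image _ id hne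
  simp only [Finset.mem_filter, Finset.mem_univ, true_and, id] at hi hmax
  have hil : i ≠ Fin.last n := by
    rintro rfl
    have := x.2.2
    linarith
  obtain ⟨j, rfl⟩ := Fin.exists_castSucc_eq.mpr hil
  have hx1 : (x : ℝ) < a j.succ := by
    by_contra hcon
    have := hmax _ (not_lt.mp hcon)
    exact absurd j.castSucc_lt_succ (not_lt.mpr this)
  have hy1 : (y : ℝ) < a j.succ := by
    by_contra hcon
    exact hs _ ⟨_, rfl⟩ ⟨hx1, not_lt.mp hcon⟩
  obtain ⟨c, hc⟩ := h j
  simp only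
  rw [hc x ⟨hi, hx1⟩, hc y ⟨hi.trans hxy, hy1⟩]
  ring

lemma PC.comp_IET {β : Type*} {f : I01 → β} (hf : PC f) {T : Equiv.Perm I01} (hT : IsIET T) :
    PC fun x => f (T x) := by
  obtain ⟨S, hS, h⟩ := hf
  obtain ⟨S', hS', h'⟩ := PC_of_isIET T hT
  refine ⟨S' ∪ (fun z : I01 => (z : ℝ)) '' ((fun z : I01 => (T z : ℝ)) ⁻¹' S),
    hS'.union ((hS.preimage ?_).image _), fun x y hxy hs => ?_⟩
  · exact (Subtype.val_injective.comp T.injective).injOn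
  · have key : ∀ z : I01, (x : ℝ) ≤ z → (z : ℝ) ≤ y → (T x : ℝ) - x = (T z : ℝ) - z :=
      fun z hxz hzy => h' x z hxz fun s hs1 hs2 => hs s (Or.inl hs1) ⟨hs2.1, hs2.2.trans hzy⟩
    have hy := key y hxy le_rfl
    apply h
    · linarith
    · rintro s hsS ⟨hs1, hs2⟩
      have hz1 : (x : ℝ) < s - ((T x : ℝ) - x) := by linarith
      have hz2 : s - ((T x : ℝ) - x) ≤ y := by linarith
      let z : I01 := ⟨s - ((T x : ℝ) - x), x.2.1.trans hz1.le, hz2.trans_lt y.2.2⟩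
      have hz := key z hz1.le hz2
      have hzv : (z : ℝ) = s - ((T x : ℝ) - x) := rfl
      refine hs z (Or.inr ⟨z, ?_, rfl⟩) ⟨hz1, hz2⟩
      have : (T z : ℝ) = s := by linarith
      simpa [this] using hsS

lemma PC_indicator {A : Type*} [AddCommGroup A] {J : Set I01} (hJ : IsSubdomain J) (a : A) :
    PC (J.indicator fun _ => a) := by
  classical
  obtain ⟨-, F, -, hF⟩ := hJ
  refine ⟨(F.image Prod.fst ∪ F.image Prod.snd : Finset ℝ), Finset.finite_toSet _,
    fun x y hxy hs => ?_⟩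
  have : x ∈ J ↔ y ∈ J := by
    rw [hF, hF]
    refine exists_congr fun p => and_congr_right fun hp => ?_
    have h1 := hs p.1 (by
      simp only [Finset.coe_union, Finset.coe_image]
      exact Or.inl ⟨p, hp, rfl⟩)
    have h2 := hs p.2 (by
      simp only [Finset.coe_union, Finset.coe_image]
      exact Or.inr ⟨p, hp, rfl⟩)
    rw [Set.mem_Ico, Set.mem_Ico]
    grind
  by_cases hx : x ∈ J
  · rw [Set.indicator_of_mem hx, Set.indicator_of_mem (this.mp hx)]
  · rw [Set.indicator_of_notMem hx, Set.indicator_of_notMem (fun h => hx (this.mpr h))]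

lemma PC_of_mem (G : Subgroup (Equiv.Perm I01)) (hG : ∀ g ∈ G, IsIET g)
    (A : Type*) [AddCommGroup A] (J : Set I01) (hJ : IsSubdomain J) (f : I01 → A)
    (hf : f ∈ genInvSubgroup A G {f | ∃ a : A, f = J.indicator fun _ => a}) : PC f := by
  let K : AddSubgroup (I01 → A) :=
    { carrier := {f | PC f}
      zero_mem' := PC.const (0 : A)
      add_mem' := fun {f g} hf hg => PC.map₂ hf hg (· + ·)
      neg_mem' := fun {f} hf => PC.map₂ hf hf (fun x _ => -x) }
  rw [genInvSubgroup, AddSubgroup.mem_sInf] at hf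
  refine hf K ⟨?_, ?_⟩
  · rintro _ ⟨a, rfl⟩
    exact PC_indicator hJ a
  · intro g hg f hf
    exact PC.comp_IET (T := g⁻¹) hf (hG _ (G.inv_mem hg))

/-- `[0,1) × {0,…,n-1}` glued into `[0,1)`. -/
noncomputable def glueFun (n : ℕ) [NeZero n] (p : I01 × Fin n) : I01 :=
  ⟨((p.2 : ℕ) + (p.1 : ℝ)) / n, by
    have hn : (0 : ℝ) < n := by exact_mod_cast Nat.pos_of_ne_zero (NeZero.ne n)
    have h0 := p.1.2.1
    have h1 := p.1.2.2
    have h2 : ((p.2 : ℕ) : ℝ) + 1 ≤ n := by exact_mod_cast p.2.2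
    constructor
    · positivity
    · rw [div_lt_one hn]; linarith⟩

lemma glueFun_bij (n : ℕ) [NeZero n] : Function.Bijective (glueFun n) := by
  have hn : (0 : ℝ) < n := by exact_mod_cast Nat.pos_of_ne_zero (NeZero.ne n)
  constructor
  · rintro ⟨x, k⟩ ⟨y, l⟩ h
    have h' : ((k : ℕ) + (x : ℝ)) / n = ((l : ℕ) + (y : ℝ)) / n := congrArg Subtype.val h
    rw [div_left_inj' hn.ne'] at h'
    have hx0 := x.2.1
    have hx1 := x.2.2
    have hy0 := y.2.1
    have hy1 := y.2.2
    have h1 : (k : ℕ) < (l : ℕ) + 1 := by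
      have : ((k : ℕ) : ℝ) < (l : ℕ) + 1 := by linarith
      exact_mod_cast this
    have h2 : (l : ℕ) < (k : ℕ) + 1 := by
      have : ((l : ℕ) : ℝ) < (k : ℕ) + 1 := by linarith
      exact_mod_cast this
    have hkl : k = l := Fin.ext (by omega)
    subst hkl
    have : x = y := Subtype.ext (by linarith)
    rw [this]
  · intro y
    have hy0 : 0 ≤ (n : ℝ) * y := mul_nonneg hn.le y.2.1
    have hy1 : (n : ℝ) * y < n := by nlinarith [y.2.2]
    have hf := Nat.floor_le hy0
    have hf' := Nat.lt_floor_add_one ((n : ℝ) * y)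
    refine ⟨(⟨(n : ℝ) * y - ⌊(n : ℝ) * y⌋₊, by linarith, by linarith⟩,
      ⟨⌊(n : ℝ) * y⌋₊, (Nat.floor_lt hy0).mpr hy1⟩), Subtype.ext ?_⟩
    simp only [glueFun]
    field_simp
    ring

/-- The gluing bijection. -/
noncomputable def glue (n : ℕ) [NeZero n] : I01 × Fin n ≃ I01 :=
  Equiv.ofBijective _ (glueFun_bij n)

lemma glue_val (n : ℕ) [NeZero n] (x : I01) (k : Fin n) :
    (glue n (x, k) : ℝ) = ((k : ℕ) + (x : ℝ)) / n := rfl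

lemma glue_PC {β : Type*} (n : ℕ) [NeZero n] (f : I01 → β)
    (h : ∀ k, PC fun x => f (glue n (x, k))) : PC f := by
  have hn : (0 : ℝ) < n := by exact_mod_cast Nat.pos_of_ne_zero (NeZero.ne n)
  choose S hS h using h
  refine ⟨(⋃ k : Fin n, (fun s : ℝ => ((k : ℕ) + s) / n) '' S k) ∪
    Set.range (fun k : Fin n => ((k : ℕ) : ℝ) / n), ?_, ?_⟩
  · exact (Set.finite_iUnion fun k => (hS k).image _).union (Set.finite_range _)
  · intro u v huv hs
    obtain ⟨⟨x, k⟩, rfl⟩ := (glue n).surjective u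
    obtain ⟨⟨y, l⟩, rfl⟩ := (glue n).surjective v
    simp only [glue_val] at huv hs
    have hx0 := x.2.1
    have hx1 := x.2.2
    have hy0 := y.2.1
    have hy1 := y.2.2
    rw [div_le_div_iff_of_pos_right hn] at huv
    have hkl : k = l := by
      rcases lt_trichotomy k l with hlt | heq | hlt
      · exfalso
        have h2 : ((k : ℕ) : ℝ) + 1 ≤ (l : ℕ) := by exact_mod_cast hlt
        refine hs (((l : ℕ) : ℝ) / n) (Or.inr ⟨l, rfl⟩) ⟨?_, ?_⟩
        · rw [div_lt_div_iff_of_pos_right hn]; linarith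
        · rw [div_le_div_iff_of_pos_right hn]; linarith
      · exact heq
      · exfalso
        have h2 : ((l : ℕ) : ℝ) + 1 ≤ (k : ℕ) := by exact_mod_cast hlt
        linarith
    subst hkl
    refine h k x y (by linarith) fun s hsS hsxy => ?_
    refine hs (((k : ℕ) + s) / n) (Or.inl (Set.mem_iUnion.mpr ⟨k, s, hsS, rfl⟩)) ⟨?_, ?_⟩
    · rw [div_lt_div_iff_of_pos_right hn]; linarith
    · rw [div_le_div_iff_of_pos_right hn]; linarith

/-- The action of the lamplighter-like group on `X × A`. -/
def llAct {X : Type*} (A : Type*) [AddCommGroup A] (G : Subgroup (Equiv.Perm X))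
    (gens : Set (X → A)) : LLGroup A G gens →* Equiv.Perm (X × A) where
  toFun w :=
    { toFun := fun p => (w.right.1 p.1, p.2 + (Multiplicative.toAdd w.left).1 (w.right.1 p.1))
      invFun := fun p => (w.right.1.symm p.1, p.2 - (Multiplicative.toAdd w.left).1 p.1)
      left_inv := fun p => by simp
      right_inv := fun p => by simp }
  map_one' := by
    ext p <;> simp
  map_mul' := fun v w => by
    ext p
    · simp
    · simp [llShift, shiftF]
      abel

lemma llAct_apply {X : Type*} (A : Type*) [AddCommGroup A] (G : Subgroup (Equiv.Perm X))
    (gens : Set (X → A)) (w : LLGroup A G gens) (x : X) (a : A) :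
    llAct A G gens w (x, a) = (w.right.1 x, a + (Multiplicative.toAdd w.left).1 (w.right.1 x)) :=
  rfl

lemma llAct_inj {X : Type*} (A : Type*) [AddCommGroup A] (G : Subgroup (Equiv.Perm X))
    (gens : Set (X → A)) : Function.Injective (llAct A G gens) := by
  intro v w h
  have h' : ∀ x, _ := fun x => congrArg (fun T : Equiv.Perm (X × A) => T (x, (0 : A))) h
  simp only [llAct_apply, Prod.mk.injEq, zero_add] at h'
  have hr : v.right = w.right := Subtype.ext (Equiv.ext fun x => (h' x).1)
  refine SemidirectProduct.ext ?_ hr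
  apply Multiplicative.toAdd.injective
  apply Subtype.ext
  funext x
  have := (h' (v.right.1.symm x)).2
  rw [← hr] at this
  simpa using this

/-- Lamplighter-like construction: for `G < IET`, `A` a finite abelian group and `J` a
subdomain of `[0,1)`, the semidirect product `F_J ⋊ G` embeds in `IET`, where `F_J` is the
smallest `G`-invariant subgroup of `A^{[0,1)}` containing the functions `a·1_J`. -/
theorem lamplighterLike_embeds_in_IET
    (G : Subgroup (Equiv.Perm I01)) (hG : ∀ g ∈ G, IsIET g)
    (A : Type*) [AddCommGroup A] [Finite A]
    (J : Set I01) (hJ : IsSubdomain J) :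
    ∃ ψ : LLGroup A G {f | ∃ a : A, f = J.indicator fun _ => a} →* Equiv.Perm I01,
      Function.Injective ψ ∧ ∀ w, IsIET (ψ w) := by
  classical
  let n := Nat.card A
  have : NeZero n := ⟨Nat.card_pos.ne'⟩
  let e : A ≃ Fin n := Finite.equivFin A
  let φ : I01 × A ≃ I01 := ((Equiv.refl I01).prodCongr e).trans (glue n)
  refine ⟨(φ.permCongrHom : _ →* _).comp (llAct A G _), ?_, fun w => ?_⟩
  · exact φ.permCongrHom.injective.comp (llAct_inj A G _)
  · apply isIET_of_PC
    apply glue_PC n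
    intro k
    have hg := hG _ w.right.2
    have hf := (PC_of_mem G hG A J hJ _ (Multiplicative.toAdd w.left).2).comp_IET hg
    have hm := PC.map₂ hf (PC_of_isIET _ hg) (fun a d =>
      ((((e (e.symm k + a) : Fin n) : ℕ) : ℝ) - (k : ℕ) + d) / n)
    convert hm using 2 with x
    have h1 : φ.symm (glue n (x, k)) = (x, e.symm k) := by
      rw [Equiv.symm_apply_eq]
      simp [φ]
    have h2 : ((φ.permCongrHom : Equiv.Perm (I01 × A) →* Equiv.Perm I01).comp (llAct A G _)) w (glue n (x, k)) =
        φ (llAct A G _ w (φ.symm (glue n (x, k)))) := rfl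
    rw [h2, h1, llAct_apply]
    have h3 : ∀ (z : I01) (a : A), φ (z, a) = glue n (z, e a) := fun _ _ => rfl
    rw [h3, glue_val, glue_val]
    ring
end
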